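/- arXiv:2205.04106 — 4 statements merged into one kernel-verified Lean document; each statement's English description precedes it below -/
import Mathlib

section
/- Let n ≥ 1, N = 2n+2, 0 < α < 2, and let φ(r) = r^{α/2}. Then there is a constant C > 0, depending only on n, α and R*, such that for every j ∈ ℤ, every t ≠ 0 and every (z,s) ∈ ℂ^n × ℝ, the fractional wave kernel satisfies |F_j^φ(t,z,s)| ≤ C |t|^{−1/2} 2^{j(N−α/2)}. -/
open MeasureTheory

/-- Squared Euclidean norm of `z ∈ ℂⁿ`. -/
noncomputable def hnormSq {n : ℕ} (z : Fin n → ℂ) : ℝ := ∑ j, Complex.normSq (z j)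

/-- Laguerre polynomial of type `d` and degree `m`. -/
noncomputable def laguerreL (d m : ℕ) (t : ℝ) : ℝ :=
  ∑ k ∈ Finset.range (m + 1),
    (-1 : ℝ) ^ k * (Nat.choose (m + d) (m - k)) * t ^ k / (Nat.factorial k)

/-- The `m`-th term of the series defining the kernel `F_j^φ(t,z,s)` of the
frequency-localized propagator `e^{itφ(𝓛)}φ_j` on the Heisenberg group. -/
noncomputable def Fterm (n : ℕ) (R φ : ℝ → ℝ) (j : ℤ) (t : ℝ)
    (z : Fin n → ℂ) (s : ℝ) (m : ℕ) : ℂ :=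
  ∫ lam : ℝ,
    Complex.exp (-(Complex.I * lam * s)) *
      Complex.exp (Complex.I * t * (φ (4 * (2 * (m : ℝ) + n) * |lam|) : ℝ)) *
      ((R ((2 : ℝ) ^ (-(2 : ℤ) * j) * (2 * (m : ℝ) + n) * |lam|) *
        laguerreL (n - 1) m (2 * |lam| * hnormSq z) *
        Real.exp (-(|lam| * hnormSq z)) * |lam| ^ n : ℝ) : ℂ)

/-- The kernel `F_j^φ(t,z,s)` of the frequency-localized propagator `e^{itφ(𝓛)}φ_j`
on the Heisenberg group `Hⁿ`. -/
noncomputable def Fkernel (n : ℕ) (R φ : ℝ → ℝ) (j : ℤ) (t : ℝ)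
    (z : Fin n → ℂ) (s : ℝ) : ℂ :=
  (((2 : ℝ) ^ (n - 1) / Real.pi ^ (n + 1) : ℝ) : ℂ) * ∑' m : ℕ, Fterm n R φ j t z s m

open Polynomial in
noncomputable def lagP (d m : ℕ) : Polynomial ℝ :=
  ∑ k ∈ Finset.range (m + 1),
    Polynomial.C ((-1 : ℝ) ^ k * (Nat.choose (m + d) (m - k)) / (Nat.factorial k)) * Polynomial.X ^ k

lemma lagP_eval (d m : ℕ) (x : ℝ) : (lagP d m).eval x = laguerreL d m x := by
  simp only [lagP, laguerreL, Polynomial.eval_finsetSum]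
  refine Finset.sum_congr rfl fun k _ => ?_
  simp
  ring

lemma lagP_coeff (d m k : ℕ) : (lagP d m).coeff k =
    if k < m + 1 then ((-1 : ℝ) ^ k * (Nat.choose (m + d) (m - k)) / (Nat.factorial k)) else 0 := by
  simp only [lagP, Polynomial.finsetSum_coeff, Polynomial.coeff_C_mul_X_pow]
  simp

lemma lagP_rec (d m k : ℕ) :
    ((k : ℝ) + 1) * (k + d + 1) * (lagP d m).coeff (k + 1) = (k - m) * (lagP d m).coeff k := by
  rw [lagP_coeff, lagP_coeff]
  by_cases h : k + 1 < m + 1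
  · have h' : k < m + 1 := by omega
    rw [if_pos h, if_pos h']
    obtain ⟨i, rfl⟩ : ∃ i, m = k + 1 + i := ⟨m - (k+1), by omega⟩
    have e1 : k + 1 + i - (k + 1) = i := by omega
    have e2 : k + 1 + i - k = i + 1 := by omega
    rw [e1, e2]
    have := Nat.choose_succ_right_eq (k + 1 + i + d) i
    have e3 : k + 1 + i + d - i = k + 1 + d := by omega
    rw [e3] at this
    have h2 : ((k + 1 + i + d).choose (i+1) : ℝ) * (i + 1) = ((k + 1 + i + d).choose i : ℝ) * (k + 1 + d) := by
      exact_mod_cast this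
    have hf : ((k.factorial : ℕ) : ℝ) ≠ 0 := by positivity
    rw [Nat.factorial_succ]
    push_cast
    field_simp
    rw [pow_succ]
    linear_combination (-1 : ℝ)^k * h2
  · rw [if_neg h]
    by_cases h' : k < m + 1
    · have : k = m := by omega
      subst this; simp
    · rw [if_neg h']; simp

lemma lagP_ode (d m : ℕ) :
    Polynomial.X * (lagP d m).derivative.derivative
      + (Polynomial.C ((d : ℝ) + 1) - Polynomial.X) * (lagP d m).derivative
      + Polynomial.C (m : ℝ) * lagP d m = 0 := by
  ext k
  have h := lagP_rec d m k
  rcases k with _ | k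
  · simp only [sub_mul, Polynomial.coeff_add, Polynomial.coeff_sub, Polynomial.coeff_C_mul, Polynomial.mul_coeff_zero, Polynomial.coeff_X_zero, Polynomial.coeff_C_zero, Polynomial.coeff_derivative, Polynomial.coeff_zero]
    push_cast at h ⊢
    linear_combination h
  · simp only [sub_mul, Polynomial.coeff_add, Polynomial.coeff_sub, Polynomial.coeff_C_mul, Polynomial.coeff_X_mul, Polynomial.coeff_derivative, Polynomial.coeff_zero]
    push_cast at h ⊢
    linear_combination h

noncomputable def lf (d m : ℕ) (x : ℝ) : ℝ := (lagP d m).eval x * Real.exp (-(x/2))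
noncomputable def lf1 (d m : ℕ) (x : ℝ) : ℝ :=
  ((lagP d m).derivative.eval x - (lagP d m).eval x / 2) * Real.exp (-(x/2))
noncomputable def lf2 (d m : ℕ) (x : ℝ) : ℝ :=
  ((lagP d m).derivative.derivative.eval x - (lagP d m).derivative.eval x
    + (lagP d m).eval x / 4) * Real.exp (-(x/2))

lemma exphalf (x : ℝ) : HasDerivAt (fun x : ℝ => Real.exp (-(x/2))) (Real.exp (-(x/2)) * (-(1/2))) x := by
  have := (((hasDerivAt_id x).div_const 2).neg).exp
  simpa using this

lemma lf_d (d m : ℕ) (x : ℝ) : HasDerivAt (lf d m) (lf1 d m x) x := by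
  have := ((lagP d m).hasDerivAt x).mul (exphalf x)
  refine HasDerivAt.congr_deriv this ?_
  simp only [lf1]; ring

lemma lf1_d (d m : ℕ) (x : ℝ) : HasDerivAt (lf1 d m) (lf2 d m x) x := by
  have := (((lagP d m).derivative.hasDerivAt x).sub (((lagP d m).hasDerivAt x).div_const 2)).mul (exphalf x)
  refine HasDerivAt.congr_deriv this ?_
  simp only [lf2, Pi.sub_apply]; ring

lemma lf_ode (d m : ℕ) (x : ℝ) :
    x * lf2 d m x + (d + 1) * lf1 d m x + ((2 * (m:ℝ) + d + 1) / 2 - x / 4) * lf d m x = 0 := by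
  have h := congrArg (Polynomial.eval x) (lagP_ode d m)
  simp at h
  simp only [lf, lf1, lf2]
  linear_combination Real.exp (-(x/2)) * h

lemma lf_decay (d m : ℕ) :
    Filter.Tendsto (fun x => x ^ (d+1) * lf d m x * lf1 d m x) Filter.atTop (nhds 0) := by
  have := Polynomial.tendsto_div_exp_atTop (Polynomial.X ^ (d+1) * lagP d m *
    ((lagP d m).derivative - Polynomial.C (1/2) * lagP d m))
  refine this.congr fun x => ?_
  have : Real.exp x = (Real.exp (x/2)) * Real.exp (x/2) := by rw [← Real.exp_add]; ring_nf
  simp only [lf, lf1, Real.exp_neg, this]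
  simp
  field_simp

lemma lf_zero (d m : ℕ) : lf d m 0 = Nat.choose (m + d) m := by
  have := lagP_coeff d m 0
  rw [Polynomial.coeff_zero_eq_eval_zero] at this
  simp [lf, this]
section abs
open Set

/-- abstract data of a Laguerre function -/
structure LagData (f f1 f2 : ℝ → ℝ) (d : ℕ) (M : ℝ) : Prop where
  hf : ∀ x, HasDerivAt f (f1 x) x
  hf1 : ∀ x, HasDerivAt f1 (f2 x) x
  ode : ∀ x, x * f2 x + (d + 1) * f1 x + (M / 2 - x / 4) * f x = 0
  dec : Filter.Tendsto (fun x => x ^ (d+1) * f x * f1 x) Filter.atTop (nhds 0)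
  hM : 1 ≤ M

variable {f f1 f2 : ℝ → ℝ} {d : ℕ} {M : ℝ}

lemma LagData.energy (h : LagData f f1 f2 d M) {x : ℝ} (hx : 0 ≤ x) :
    x * f1 x ^ 2 + (M / 2 - x / 4) * f x ^ 2 ≤ M / 2 * f 0 ^ 2 := by
  have hd : ∀ y, HasDerivAt (fun y => y * f1 y ^ 2 + (M / 2 - y / 4) * f y ^ 2)
      (-(2 * d + 1) * f1 y ^ 2 - f y ^ 2 / 4) y := by
    intro y
    have := ((hasDerivAt_id y).mul ((h.hf1 y).pow 2)).add
      ((((hasDerivAt_id y).div_const 4).const_sub (M/2)).mul ((h.hf y).pow 2))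
    refine HasDerivAt.congr_deriv this ?_
    simp only [id, Pi.pow_apply, Pi.mul_apply]
    push_cast
    try simp only [Nat.add_sub_cancel, pow_one]
    have hode := h.ode y
    first
      | linear_combination (-2 * f1 y) * hode
      | linear_combination (2 * f1 y) * hode
  have := antitone_of_deriv_nonpos (fun y => (hd y).differentiableAt) (fun y => by
    rw [(hd y).deriv]
    nlinarith [sq_nonneg (f1 y), sq_nonneg (f y), mul_nonneg (Nat.cast_nonneg d : (0:ℝ) ≤ d) (sq_nonneg (f1 y))])
  have := this hx
  simpa using this

lemma LagData.f1_bound (h : LagData f f1 f2 d M) {x : ℝ} (hx : 0 < x) (hx2 : x ≤ 2 * M) :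
    |f1 x| ≤ √(2 * M) * |f 0| * (1 / (2 * √x)) := by
  have hM := h.hM
  have e := h.energy hx.le
  have e2 : x * f1 x ^ 2 ≤ M / 2 * f 0 ^ 2 := by
    have : 0 ≤ (M / 2 - x / 4) * f x ^ 2 := mul_nonneg (by linarith) (sq_nonneg _)
    linarith
  have hs := Real.sqrt_pos.mpr hx
  refine abs_le_of_sq_le_sq ?_ (by positivity)
  have : (√(2 * M) * |f 0| * (1 / (2 * √x))) ^ 2 = M / 2 * f 0 ^ 2 / x := by
    rw [mul_pow, mul_pow, Real.sq_sqrt (by linarith), sq_abs, div_pow, mul_pow, Real.sq_sqrt hx.le]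
    field_simp
    try ring
  rw [this, le_div_iff₀ hx]; linarith

lemma LagData.var_le (h : LagData f f1 f2 d M) {a b : ℝ} (ha : 0 < a) (hab : a ≤ b) (hb : b ≤ 2 * M) :
    ∫ x in a..b, |f1 x| ≤ √(2 * M) * |f 0| * (√b - √a) := by
  have hc : Continuous f1 := continuous_iff_continuousAt.mpr fun x => (h.hf1 x).continuousAt
  have hco : ContinuousOn (fun x : ℝ => √(2 * M) * |f 0| * (1 / (2 * √x))) (uIcc a b) := by
    rw [uIcc_of_le hab]
    apply ContinuousOn.mul continuousOn_const
    apply ContinuousOn.div continuousOn_const (by fun_prop)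
    intro x hx
    have := Real.sqrt_pos.mpr (lt_of_lt_of_le ha hx.1)
    positivity
  have h1 : ∫ x in a..b, |f1 x| ≤ ∫ x in a..b, √(2 * M) * |f 0| * (1 / (2 * √x)) := by
    apply intervalIntegral.integral_mono_on hab (hc.abs.intervalIntegrable _ _)
      hco.intervalIntegrable
    intro x hx
    exact h.f1_bound (lt_of_lt_of_le ha hx.1) (hx.2.trans hb)
  refine h1.trans (le_of_eq ?_)
  rw [intervalIntegral.integral_eq_sub_of_hasDerivAt (f := fun x => √(2 * M) * |f 0| * √x)]
  · ring
  · intro x hx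
    rw [uIcc_of_le hab] at hx
    exact (Real.hasDerivAt_sqrt (lt_of_lt_of_le ha hx.1).ne').const_mul _
  · exact hco.intervalIntegrable

lemma LagData.bound_left (h : LagData f f1 f2 d M) {x : ℝ} (hx : 0 ≤ x) (hx2 : x ≤ 2 * M) :
    |f x| ≤ 3 * √M * |f 0| := by
  have hM := h.hM
  have hMs : 1 ≤ √M := Real.one_le_sqrt.mpr hM
  have key : ∀ y, 0 ≤ y → y ≤ 2 * M - 2 → |f y| ≤ √M * |f 0| := by
    intro y hy hy2
    have e := h.energy hy
    refine abs_le_of_sq_le_sq ?_ (by positivity)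
    rw [mul_pow, Real.sq_sqrt (by linarith), sq_abs]
    have : 0 ≤ y * f1 y ^ 2 := by positivity
    nlinarith [sq_nonneg (f y)]
  rcases le_total x (2 * M - 2) with h1 | h1
  · have := key x hx h1
    nlinarith [abs_nonneg (f 0), Real.sqrt_nonneg M, mul_nonneg (Real.sqrt_nonneg M) (abs_nonneg (f 0))]
  · set x0 := 2 * M - 2 with hx0
    have hx00 : 0 ≤ x0 := by linarith
    have k0 := key x0 hx00 le_rfl
    have hcf : Continuous f := continuous_iff_continuousAt.mpr fun x => (h.hf x).continuousAt
    have aux : ∀ ε : ℝ, |ε| = 1 → ε * f x - √(2*M) * |f 0| * √x ≤ ε * f x0 - √(2*M) * |f 0| * √x0 := by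
      intro ε hε
      have hd : ∀ y ∈ Ioo x0 x, HasDerivAt (fun y => ε * f y - √(2*M) * |f 0| * √y)
          (ε * f1 y - √(2*M) * |f 0| * (1 / (2 * √y))) y := by
        intro y hy
        exact ((h.hf y).const_mul ε).sub
          ((Real.hasDerivAt_sqrt (lt_of_le_of_lt hx00 hy.1).ne').const_mul _)
      have := antitoneOn_of_deriv_nonpos (convex_Icc x0 x)
        (f := fun y => ε * f y - √(2*M) * |f 0| * √y) (by fun_prop)
        (by
          rw [interior_Icc]
          intro y hy
          exact (hd y hy).differentiableAt.differentiableWithinAt)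
        (by
          rw [interior_Icc]
          intro y hy
          rw [(hd y hy).deriv]
          have b := h.f1_bound (lt_of_le_of_lt hx00 hy.1) (hy.2.le.trans hx2)
          have : ε * f1 y ≤ |f1 y| := by
            calc ε * f1 y ≤ |ε * f1 y| := le_abs_self _
              _ = |f1 y| := by rw [abs_mul, hε, one_mul]
          linarith)
      exact this ⟨le_rfl, h1⟩ ⟨h1, le_rfl⟩ h1
    have hs : √x - √x0 ≤ √2 := by
      have : √x ≤ √(x0 + 2) := Real.sqrt_le_sqrt (by linarith)
      have h3 : √(x0 + 2) ≤ √x0 + √2 := Real.sqrt_le_iff.mpr ⟨by positivity, by nlinarith [Real.sq_sqrt hx00, Real.sq_sqrt (show (0:ℝ) ≤ 2 by norm_num), mul_nonneg (Real.sqrt_nonneg x0) (Real.sqrt_nonneg 2)]⟩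
      linarith
    have h2M : √(2*M) * √2 = 2 * √M := by
      rw [Real.sqrt_mul (by norm_num)]
      nlinarith [Real.mul_self_sqrt (show (0:ℝ) ≤ 2 by norm_num)]
    have hh : √(2*M) * |f 0| * (√x - √x0) ≤ 2 * √M * |f 0| := by
      calc √(2*M) * |f 0| * (√x - √x0) ≤ √(2*M) * |f 0| * √2 := by gcongr
        _ = (√(2*M) * √2) * |f 0| := by ring
        _ = _ := by rw [h2M]
    have a1 := aux 1 (by simp)
    have a2 := aux (-1) (by simp)
    have := abs_le.mp k0
    rw [abs_le]; constructor <;> nlinarith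

lemma LagData.mono_right (h : LagData f f1 f2 d M) {x : ℝ} (hx : 2 * M ≤ x) : f x * f1 x ≤ 0 := by
  have hM := h.hM
  have hd : ∀ y, HasDerivAt (fun y => y ^ (d+1) * f y * f1 y)
      (y ^ (d+1) * f1 y ^ 2 + (y / 4 - M / 2) * y ^ d * f y ^ 2) y := by
    intro y
    have := (((hasDerivAt_id y).pow (d+1)).mul (h.hf y)).mul (h.hf1 y)
    refine HasDerivAt.congr_deriv this ?_
    simp only [id, Pi.pow_apply, Pi.mul_apply]
    push_cast
    try simp only [Nat.add_sub_cancel, pow_one]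
    have hode := h.ode y
    first
      | linear_combination (y ^ d * f y) * hode
      | linear_combination (-(y ^ d * f y)) * hode
  have mono : MonotoneOn (fun y => y ^ (d+1) * f y * f1 y) (Ici (2 * M)) := by
    apply monotoneOn_of_deriv_nonneg (convex_Ici _)
    · intro y _; exact (hd y).continuousAt.continuousWithinAt
    · intro y _; exact (hd y).differentiableAt.differentiableWithinAt
    · rw [interior_Ici]
      intro y hy
      have hy : 2 * M < y := hy
      have : 0 < y := by linarith
      rw [(hd y).deriv]
      have : 0 ≤ y / 4 - M / 2 := by linarith
      positivity
  have : x ^ (d+1) * f x * f1 x ≤ 0 := by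
    refine ge_of_tendsto h.dec ?_
    filter_upwards [Filter.eventually_ge_atTop x] with y hy
    exact mono hx (hx.trans hy) hy
  have hp : 0 < x ^ (d+1) := by
    have : 0 < x := by linarith
    positivity
  by_contra hc
  push Not at hc
  nlinarith [mul_pos hp hc]

lemma LagData.abs_anti (h : LagData f f1 f2 d M) {a b : ℝ} (ha : 2 * M ≤ a) (hab : a ≤ b) :
    |f b| ≤ |f a| := by
  have anti : AntitoneOn (fun y => f y ^ 2) (Ici (2 * M)) := by
    have hd : ∀ y, HasDerivAt (fun y => f y ^ 2) (2 * (f y * f1 y)) y := by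
      intro y
      have := (h.hf y).pow 2
      refine HasDerivAt.congr_deriv this ?_
      push_cast; ring
    apply antitoneOn_of_deriv_nonpos (convex_Ici _)
    · intro y _; exact (hd y).continuousAt.continuousWithinAt
    · intro y _; exact (hd y).differentiableAt.differentiableWithinAt
    · rw [interior_Ici]
      intro y hy
      rw [(hd y).deriv]
      have := h.mono_right (le_of_lt hy)
      linarith
  exact sq_le_sq.mp (anti ha (ha.trans hab) hab)

lemma LagData.bound (h : LagData f f1 f2 d M) {x : ℝ} (hx : 0 ≤ x) :
    |f x| ≤ 3 * √M * |f 0| := by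
  rcases le_total x (2 * M) with h1 | h1
  · exact h.bound_left hx h1
  · exact (h.abs_anti le_rfl h1).trans (h.bound_left (by linarith [h.hM]) le_rfl)

lemma LagData.neg (h : LagData f f1 f2 d M) :
    LagData (fun x => - f x) (fun x => - f1 x) (fun x => - f2 x) d M where
  hf := fun x => (h.hf x).neg
  hf1 := fun x => (h.hf1 x).neg
  ode := fun x => by linear_combination - h.ode x
  dec := by
    refine h.dec.congr fun x => by ring
  hM := h.hM

lemma LagData.var_right_pos (h : LagData f f1 f2 d M) {a b : ℝ} (ha : 2 * M ≤ a) (hab : a ≤ b)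
    (hp : 0 ≤ f a) : ∫ x in a..b, |f1 x| ≤ f a := by
  have hcf : Continuous f := continuous_iff_continuousAt.mpr fun x => (h.hf x).continuousAt
  have hc : Continuous f1 := continuous_iff_continuousAt.mpr fun x => (h.hf1 x).continuousAt
  have pos : ∀ y, a ≤ y → 0 ≤ f y := by
    intro y hy
    by_contra hn
    push Not at hn
    obtain ⟨c, hc1, hc2⟩ := intermediate_value_Icc' hy hcf.continuousOn (show (0:ℝ) ∈ Icc (f y) (f a) from ⟨hn.le, hp⟩)
    have := h.abs_anti (ha.trans hc1.1) hc1.2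
    rw [hc2, abs_zero] at this
    have := abs_nonpos_iff.mp this
    linarith
  have anti : ∀ x y, a ≤ x → x ≤ y → f y ≤ f x := by
    intro x y hx hy
    have := h.abs_anti (ha.trans hx) hy
    rwa [abs_of_nonneg (pos y (hx.trans hy)), abs_of_nonneg (pos x hx)] at this
  have npos : ∀ x ∈ Ioo a b, f1 x ≤ 0 := by
    intro x hx
    have h1 : AntitoneOn f (Ici a) := fun x hx y _ hxy => anti x y hx hxy
    have := h1.derivWithin_nonpos (x := x)
    rwa [derivWithin_of_mem_nhds (Ici_mem_nhds hx.1), (h.hf x).deriv] at this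
  have : ∫ x in a..b, |f1 x| = ∫ x in a..b, - f1 x := by
    apply intervalIntegral.integral_congr_ae
    have : ∀ᵐ x : ℝ, x ≠ b := by simp [MeasureTheory.ae_iff]
    filter_upwards [this] with x hxb hx
    rw [uIoc_of_le hab] at hx
    exact abs_of_nonpos (npos x ⟨hx.1, lt_of_le_of_ne hx.2 hxb⟩)
  rw [this, intervalIntegral.integral_neg,
    intervalIntegral.integral_eq_sub_of_hasDerivAt (fun x _ => h.hf x) (hc.intervalIntegrable _ _)]
  linarith [pos b hab]

lemma LagData.var_right (h : LagData f f1 f2 d M) {a b : ℝ} (ha : 2 * M ≤ a) (hab : a ≤ b) :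
    ∫ x in a..b, |f1 x| ≤ |f a| := by
  rcases le_total 0 (f a) with hp | hp
  · rw [abs_of_nonneg hp]; exact h.var_right_pos ha hab hp
  · rw [abs_of_nonpos hp]
    have := h.neg.var_right_pos ha hab (by linarith)
    simpa using this

lemma LagData.var (h : LagData f f1 f2 d M) {a b : ℝ} (ha : 0 < a) (hab : a ≤ b) :
    ∫ x in a..b, |f1 x| ≤ 3 * √M * |f 0| + (if a ≤ 2 * M then √(2 * M) * |f 0| * √b else 0) := by
  have hc : Continuous f1 := continuous_iff_continuousAt.mpr fun x => (h.hf1 x).continuousAt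
  split_ifs with h1
  · rcases le_total b (2 * M) with h2 | h2
    · have := h.var_le ha hab h2
      have : 0 ≤ √(2 * M) * |f 0| * √a := by positivity
      have : 0 ≤ 3 * √M * |f 0| := by positivity
      nlinarith
    · have e1 := h.var_le ha h1 le_rfl
      have e2 := h.var_right le_rfl h2
      have e3 := h.bound (x := 2 * M) (by linarith [h.hM])
      rw [← intervalIntegral.integral_add_adjacent_intervals
        (hc.abs.intervalIntegrable a (2*M)) (hc.abs.intervalIntegrable (2*M) b)]
      have : √(2 * M) * |f 0| * (√(2*M) - √a) ≤ √(2 * M) * |f 0| * √b := by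
        gcongr
        have := Real.sqrt_le_sqrt h2
        linarith [Real.sqrt_nonneg a]
      linarith
  · push Not at h1
    have := h.var_right h1.le hab
    have := h.bound ha.le
    linarith

end abs

lemma lagData (d m : ℕ) : LagData (lf d m) (lf1 d m) (lf2 d m) d (2 * m + d + 1) where
  hf := lf_d d m
  hf1 := lf1_d d m
  ode := lf_ode d m
  dec := lf_decay d m
  hM := by have : (0:ℝ) ≤ m := by positivity
           have : (0:ℝ) ≤ d := by positivity
           linarith
section vdc
open Set Complex

lemma vdc {ψ ψ1 ψ2 A A1 : ℝ → ℝ} {a b ρ ε K : ℝ} (hab : a ≤ b) (hρ : 0 < ρ) (hε : |ε| = 1)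
    (h1 : ∀ x ∈ Icc a b, HasDerivAt ψ (ψ1 x) x) (h2 : ∀ x ∈ Icc a b, HasDerivAt ψ1 (ψ2 x) x)
    (hc2 : ContinuousOn ψ2 (Icc a b)) (hs : ∀ x ∈ Icc a b, ρ ≤ ε * ψ2 x)
    (hA : ∀ x ∈ Icc a b, HasDerivAt A (A1 x) x) (hcA : ContinuousOn A1 (Icc a b))
    (hK : ∀ x ∈ Icc a b, |A x| ≤ K) :
    ‖∫ x in a..b, Complex.exp (I * (ψ x : ℝ)) * (A x : ℝ)‖ ≤ (8 * K + ∫ x in a..b, |A1 x|) / √ρ := by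
  have hK0 : 0 ≤ K := (abs_nonneg _).trans (hK a ⟨le_rfl, hab⟩)
  set κ := √ρ with hκd
  have hκ : 0 < κ := Real.sqrt_pos.mpr hρ
  have hκ2 : κ ^ 2 = ρ := Real.sq_sqrt hρ.le
  have cψ : ContinuousOn ψ (Icc a b) := fun x hx => (h1 x hx).continuousAt.continuousWithinAt
  have cψ1 : ContinuousOn ψ1 (Icc a b) := fun x hx => (h2 x hx).continuousAt.continuousWithinAt
  have cA : ContinuousOn A (Icc a b) := fun x hx => (hA x hx).continuousAt.continuousWithinAt
  have dpos : ∀ x, 0 < ψ1 x ^ 2 + ρ := fun x => by positivity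
  set u : ℝ → ℝ := fun x => ψ1 x / (ψ1 x ^ 2 + ρ) with hu
  set u1 : ℝ → ℝ := fun x => ψ2 x * (ρ - ψ1 x ^ 2) / (ψ1 x ^ 2 + ρ) ^ 2 with hu1
  have du : ∀ x ∈ Icc a b, HasDerivAt u (u1 x) x := by
    intro x hx
    have := (h2 x hx).div (((h2 x hx).pow 2).add_const ρ) (dpos x).ne'
    refine this.congr_deriv ?_
    simp only [hu1, Pi.pow_apply]
    congr 1
    push_cast
    simp only [Nat.add_one_sub_one, pow_one]
    ring
  have cu : ContinuousOn u (Icc a b) := fun x hx => (du x hx).continuousAt.continuousWithinAt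
  have cu1 : ContinuousOn u1 (Icc a b) := by
    apply ContinuousOn.div (by fun_prop) (by fun_prop)
    intro x _; exact (pow_pos (dpos x) 2).ne'
  have ub : ∀ x, |u x| ≤ 1 / (2 * κ) := by
    intro x
    simp only [hu]
    rw [abs_div, abs_of_pos (dpos x), div_le_div_iff₀ (dpos x) (by positivity)]
    nlinarith [sq_nonneg (|ψ1 x| - κ), sq_abs (ψ1 x)]
  set e : ℝ → ℂ := fun x => Complex.exp (I * (ψ x : ℝ)) with he
  have ne : ∀ x, ‖e x‖ = 1 := by
    intro x; simp only [he]; rw [mul_comm]; exact Complex.norm_exp_ofReal_mul_I _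
  have ce : ContinuousOn e (Icc a b) := by
    simp only [he]
    fun_prop
  have de : ∀ x ∈ Icc a b, HasDerivAt e (e x * (I * (ψ1 x : ℝ))) x := by
    intro x hx
    exact ((h1 x hx).ofReal_comp.const_mul I).cexp
  set G : ℝ → ℂ := fun x => e x * (-I * (u x : ℝ)) * (A x : ℝ) with hG
  set D : ℝ → ℂ := fun x => e x * (I * (ψ1 x : ℝ)) * (-I * (u x : ℝ)) * (A x : ℝ)
     + e x * (-I * (u1 x : ℝ)) * (A x : ℝ) + e x * (-I * (u x : ℝ)) * (A1 x : ℝ) with hD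
  have dG : ∀ x ∈ Icc a b, HasDerivAt G (D x) x := by
    intro x hx
    have := ((de x hx).mul ((du x hx).ofReal_comp.const_mul (-I))).mul (hA x hx).ofReal_comp
    refine this.congr_deriv ?_
    simp only [hD, Pi.mul_apply]
    ring
  have cD : ContinuousOn D (Icc a b) := by
    simp only [hD]
    fun_prop
  set E : ℝ → ℂ := fun x => e x * ((ρ / (ψ1 x ^ 2 + ρ) : ℝ) + I * (u1 x : ℝ)) * (A x : ℝ)
    + e x * (I * (u x : ℝ)) * (A1 x : ℝ) with hE
  have cq : ContinuousOn (fun x => ρ / (ψ1 x ^ 2 + ρ)) (Icc a b) := by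
    apply ContinuousOn.div (by fun_prop) (by fun_prop)
    intro x _; exact (dpos x).ne'
  have cE : ContinuousOn E (Icc a b) := by
    simp only [hE]
    fun_prop
  have split : ∀ x, e x * (A x : ℝ) = D x + E x := by
    intro x
    simp only [hD, hE]
    have : (ψ1 x * u x : ℝ) + ρ / (ψ1 x ^ 2 + ρ) = 1 := by
      simp only [hu]
      have := (dpos x).ne'
      field_simp
    have h' : (ψ1 x : ℂ) * (u x : ℂ) + ((ρ / (ψ1 x ^ 2 + ρ) : ℝ) : ℂ) = 1 := by exact_mod_cast this
    linear_combination (-e x * A x) * h' + (e x * ψ1 x * u x * A x) * Complex.I_sq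
  have hui : uIcc a b = Icc a b := uIcc_of_le hab
  have iD : IntervalIntegrable D volume a b := ContinuousOn.intervalIntegrable (by rwa [hui])
  have iE : IntervalIntegrable E volume a b := ContinuousOn.intervalIntegrable (by rwa [hui])
  have I1 : ∫ x in a..b, e x * (A x : ℝ) = (G b - G a) + ∫ x in a..b, E x := by
    simp_rw [split]
    rw [intervalIntegral.integral_add iD iE,
      intervalIntegral.integral_eq_sub_of_hasDerivAt (fun x hx => dG x (by rwa [hui] at hx)) iD]
  have nG : ∀ x ∈ Icc a b, ‖G x‖ ≤ K / (2 * κ) := by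
    intro x hx
    simp only [hG, norm_mul, ne, norm_neg, Complex.norm_I, Complex.norm_real, Real.norm_eq_abs, one_mul]
    calc |u x| * |A x| ≤ 1 / (2 * κ) * K := by
          gcongr
          · exact ub x
          · exact hK x hx
      _ = _ := by ring
  set g : ℝ → ℝ := fun x => |A1 x| * (1 / κ) + (2 * K * ε) * (ψ2 x / (ψ1 x ^ 2 + ρ)) with hg
  have nE : ∀ x ∈ Icc a b, ‖E x‖ ≤ g x := by
    intro x hx
    have p2 : |ψ2 x| = ε * ψ2 x := by
      have : 0 ≤ ε * ψ2 x := hρ.le.trans (hs x hx)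
      rw [← abs_of_nonneg this, abs_mul, hε, one_mul]
    have b1 : ρ / (ψ1 x ^ 2 + ρ) ≤ ε * ψ2 x / (ψ1 x ^ 2 + ρ) := by
      have := hs x hx
      have := dpos x
      gcongr
    have b2 : |u1 x| ≤ ε * ψ2 x / (ψ1 x ^ 2 + ρ) := by
      simp only [hu1]
      rw [abs_div, abs_mul, p2, abs_of_pos (pow_pos (dpos x) 2), div_le_div_iff₀ (pow_pos (dpos x) 2) (dpos x)]
      have : |ρ - ψ1 x ^ 2| ≤ ψ1 x ^ 2 + ρ := by
        rw [abs_le]; constructor <;> nlinarith [sq_nonneg (ψ1 x)]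
      have h0 : 0 ≤ ε * ψ2 x := hρ.le.trans (hs x hx)
      calc ε * ψ2 x * |ρ - ψ1 x ^ 2| * (ψ1 x ^ 2 + ρ) ≤ ε * ψ2 x * (ψ1 x ^ 2 + ρ) * (ψ1 x ^ 2 + ρ) := by
            have := dpos x
            gcongr
        _ = _ := by ring
    have q0 : 0 ≤ ρ / (ψ1 x ^ 2 + ρ) := (div_pos hρ (dpos x)).le
    have t1 : ‖((ρ / (ψ1 x ^ 2 + ρ) : ℝ) : ℂ) + I * (u1 x : ℝ)‖ ≤ 2 * (ε * ψ2 x / (ψ1 x ^ 2 + ρ)) := by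
      refine (norm_add_le _ _).trans ?_
      rw [norm_mul, Complex.norm_I, Complex.norm_real, Complex.norm_real, Real.norm_eq_abs, Real.norm_eq_abs,
        abs_of_nonneg q0]
      linarith
    have t2 : |u x| ≤ 1 / κ := (ub x).trans (by
      apply one_div_le_one_div_of_le hκ; linarith)
    simp only [hE, hg]
    refine (norm_add_le _ _).trans ?_
    rw [norm_mul, norm_mul, norm_mul, norm_mul, norm_mul, ne, Complex.norm_I, Complex.norm_real, Complex.norm_real,
      Complex.norm_real, Real.norm_eq_abs, Real.norm_eq_abs, Real.norm_eq_abs, one_mul, one_mul, one_mul]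
    have s1 : ‖((ρ / (ψ1 x ^ 2 + ρ) : ℝ) : ℂ) + I * (u1 x : ℝ)‖ * |A x| ≤ 2 * (ε * ψ2 x / (ψ1 x ^ 2 + ρ)) * K :=
      mul_le_mul t1 (hK x hx) (abs_nonneg _) ((norm_nonneg _).trans t1)
    have s2 : |u x| * |A1 x| ≤ 1 / κ * |A1 x| := mul_le_mul_of_nonneg_right t2 (abs_nonneg _)
    calc _ ≤ 2 * (ε * ψ2 x / (ψ1 x ^ 2 + ρ)) * K + 1 / κ * |A1 x| := add_le_add s1 s2
      _ = _ := by ring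
  have cr : ContinuousOn (fun x => ψ2 x / (ψ1 x ^ 2 + ρ)) (Icc a b) := by
    apply ContinuousOn.div (by fun_prop) (by fun_prop)
    intro x _; exact (dpos x).ne'
  have ir : IntervalIntegrable (fun x => ψ2 x / (ψ1 x ^ 2 + ρ)) volume a b :=
    ContinuousOn.intervalIntegrable (by rwa [hui])
  have iA : IntervalIntegrable (fun x => |A1 x|) volume a b :=
    ContinuousOn.intervalIntegrable (by rw [hui]; exact hcA.abs)
  have Ig : ∫ x in a..b, g x = (∫ x in a..b, |A1 x|) * (1 / κ) +
      (2 * K * ε) * (1 / κ * Real.arctan (ψ1 b / κ) - 1 / κ * Real.arctan (ψ1 a / κ)) := by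
    simp only [hg]
    rw [intervalIntegral.integral_add (iA.mul_const _) (ir.const_mul _),
      intervalIntegral.integral_mul_const, intervalIntegral.integral_const_mul]
    congr 2
    refine intervalIntegral.integral_eq_sub_of_hasDerivAt (f := fun x => 1 / κ * Real.arctan (ψ1 x / κ)) (fun x hx => ?_) ir
    rw [hui] at hx
    have := (((h2 x hx).div_const κ).arctan).const_mul (1/κ)
    refine this.congr_deriv ?_
    rw [← hκ2]
    have : ψ1 x ^ 2 + κ ^ 2 ≠ 0 := by positivity
    have : 1 + (ψ1 x / κ) ^ 2 ≠ 0 := by positivity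
    field_simp
    try ring
  have nI : ‖∫ x in a..b, E x‖ ≤ ∫ x in a..b, g x := by
    apply intervalIntegral.norm_integral_le_of_norm_le hab
    · filter_upwards with x hx
      exact nE x ⟨hx.1.le, hx.2⟩
    · exact (iA.mul_const _).add (ir.const_mul _)
  have arc : ε * (Real.arctan (ψ1 b / κ) - Real.arctan (ψ1 a / κ)) ≤ Real.pi := by
    refine (le_abs_self _).trans ?_
    rw [abs_mul, hε, one_mul, abs_le]
    have := Real.arctan_lt_pi_div_two (ψ1 b / κ)
    have := Real.arctan_lt_pi_div_two (ψ1 a / κ)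
    have := Real.neg_pi_div_two_lt_arctan (ψ1 b / κ)
    have := Real.neg_pi_div_two_lt_arctan (ψ1 a / κ)
    constructor <;> linarith
  have fin : ‖∫ x in a..b, e x * (A x : ℝ)‖ ≤ K / (2 * κ) + K / (2 * κ) + ∫ x in a..b, g x := by
    rw [I1]
    refine (norm_add_le _ _).trans (add_le_add ((norm_sub_le _ _).trans ?_) nI)
    exact add_le_add (nG b ⟨hab, le_rfl⟩) (nG a ⟨le_rfl, hab⟩)
  refine fin.trans ?_
  rw [Ig]
  have pi := Real.pi_lt_d2
  have : (K / (2 * κ) + K / (2 * κ) + ((∫ x in a..b, |A1 x|) * (1 / κ) +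
      (2 * K * ε) * (1 / κ * Real.arctan (ψ1 b / κ) - 1 / κ * Real.arctan (ψ1 a / κ))))
      = (K + (∫ x in a..b, |A1 x|) + 2 * K * (ε * (Real.arctan (ψ1 b / κ) - Real.arctan (ψ1 a / κ)))) / κ := by
    field_simp
    ring
  rw [this]
  refine div_le_div_of_nonneg_right ?_ hκ.le
  have : 2 * K * (ε * (Real.arctan (ψ1 b / κ) - Real.arctan (ψ1 a / κ))) ≤ 2 * K * 3.15 := by
    gcongr; linarith
  linarith

end vdc
section main
open Set

lemma onesided (d m : ℕ) {β T σ y K : ℝ} {g g1 : ℝ → ℝ} (hβ : 0 < β) (hβ1 : β < 1) (hT : T ≠ 0)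
    (hy : 0 ≤ y) (hg : ∀ x, HasDerivAt g (g1 x) x) (hcg : Continuous g1)
    (hK : ∀ x ∈ Icc (1/2:ℝ) 4, |g x| ≤ K) (hK1 : ∀ x ∈ Icc (1/2:ℝ) 4, |g1 x| ≤ K) :
    ‖∫ x in (1/2:ℝ)..4, Complex.exp (Complex.I * ((T * x ^ β - σ * x : ℝ) : ℂ)) * ((g x * lf d m (y * x) : ℝ) : ℂ)‖
      ≤ K * (Nat.choose (m+d) m) * (38 * √(2 * m + d + 1) +
        (if y / 2 ≤ 2 * (2 * m + d + 1) then √(2 * (2 * m + d + 1)) * √(4 * y) else 0))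
        / √(|T| * (β * (1 - β) / 16)) := by
  have L := lagData d m
  set M : ℝ := 2 * m + d + 1 with hM
  have hB : |lf d m 0| = (Nat.choose (m+d) m : ℝ) := by
    rw [lf_zero]; exact abs_of_nonneg (by positivity)
  set B : ℝ := (Nat.choose (m+d) m : ℝ) with hBd
  have hB0 : 0 ≤ B := by positivity
  have hK0 : 0 ≤ K := (abs_nonneg _).trans (hK 1 ⟨by norm_num, by norm_num⟩)
  have cl : Continuous (lf d m) := continuous_iff_continuousAt.mpr fun x => (L.hf x).continuousAt
  have cl1 : Continuous (lf1 d m) := continuous_iff_continuousAt.mpr fun x => (L.hf1 x).continuousAt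
  have cg : Continuous g := continuous_iff_continuousAt.mpr fun x => (hg x).continuousAt
  have hTa : 0 < |T| := abs_pos.mpr hT
  have hρ : 0 < |T| * (β * (1 - β) / 16) := by
    have : 0 < 1 - β := by linarith
    positivity
  have key := vdc (a := 1/2) (b := 4) (ψ := fun x => T * x ^ β - σ * x)
    (ψ1 := fun x => T * (β * x ^ (β - 1)) - σ) (ψ2 := fun x => T * (β * ((β - 1) * x ^ (β - 1 - 1))))
    (A := fun x => g x * lf d m (y * x))
    (A1 := fun x => g1 x * lf d m (y * x) + g x * (lf1 d m (y * x) * y))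
    (ε := - (SignType.sign T : ℝ)) (K := K * (3 * √M * B)) (by norm_num) hρ
    (by
      rcases lt_or_gt_of_ne hT with h | h
      · simp [h]
      · simp [h])
    (by
      intro x hx
      have hx0 : x ≠ 0 := by have := hx.1; intro h; subst h; norm_num at this
      have := ((Real.hasDerivAt_rpow_const (x := x) (p := β) (Or.inl hx0)).const_mul T).sub
        ((hasDerivAt_id x).const_mul σ)
      refine this.congr_deriv ?_
      ring)
    (by
      intro x hx
      have hx0 : x ≠ 0 := by have := hx.1; intro h; subst h; norm_num at this
      have := (((Real.hasDerivAt_rpow_const (x := x) (p := β - 1) (Or.inl hx0)).const_mul β).const_mul T).sub_const σ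
      exact this)
    (by
      have : ContinuousOn (fun x : ℝ => x ^ (β - 1 - 1)) (Icc (1/2) 4) := by
        apply ContinuousOn.rpow_const continuousOn_id
        intro x hx
        left
        have := hx.1; intro h; simp only [id] at h; subst h; norm_num at this
      fun_prop)
    (by
      intro x hx
      have hx0 : 0 < x := by have := hx.1; linarith
      have e : -(SignType.sign T : ℝ) * (T * (β * ((β - 1) * x ^ (β - 1 - 1)))) =
          |T| * (β * (1 - β)) * x ^ (β - 1 - 1) := by
        have : (SignType.sign T : ℝ) * T = |T| := by
          rw [sign_mul_self]
        rw [← this]; ring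
      rw [e]
      have h16 : (1/16:ℝ) ≤ x ^ (β - 1 - 1) := by
        have h1 : (4:ℝ) ^ (β - 1 - 1) ≤ x ^ (β - 1 - 1) :=
          Real.rpow_le_rpow_of_nonpos hx0 hx.2 (by linarith)
        have h2 : (4:ℝ) ^ (-2 : ℝ) ≤ 4 ^ (β - 1 - 1) :=
          Real.rpow_le_rpow_of_exponent_le (by norm_num) (by linarith)
        have h3 : (4:ℝ) ^ (-2 : ℝ) = 1/16 := by
          rw [Real.rpow_neg (by norm_num)]; norm_num
        exact h3 ▸ h2.trans h1
      have : 0 ≤ |T| * (β * (1 - β)) := by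
        have : 0 < 1 - β := by linarith
        positivity
      nlinarith)
    (by
      intro x _
      have h0 : HasDerivAt (fun x => y * x) y x := by simpa using (hasDerivAt_id x).const_mul y
      exact (hg x).mul ((L.hf (y * x)).comp x h0))
    (by fun_prop)
    (by
      intro x hx
      rw [abs_mul]
      have hx0 : 0 ≤ x := by have := hx.1; linarith
      have := L.bound (x := y * x) (by positivity)
      rw [hB] at this
      exact mul_le_mul (hK x hx) this (abs_nonneg _) hK0)
  have V : ∫ x in (1/2:ℝ)..4, |g1 x * lf d m (y * x) + g x * (lf1 d m (y * x) * y)| ≤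
      (4 - 1/2) * (K * (3 * √M * B)) + K * (3 * √M * B + (if y / 2 ≤ 2 * M then √(2 * M) * B * √(4 * y) else 0)) := by
    have h1 : ∫ x in (1/2:ℝ)..4, |g1 x * lf d m (y * x) + g x * (lf1 d m (y * x) * y)| ≤
        ∫ x in (1/2:ℝ)..4, (K * (3 * √M * B) + K * (y * |lf1 d m (y * x)|)) := by
      apply intervalIntegral.integral_mono_on (by norm_num)
      · apply Continuous.intervalIntegrable; fun_prop
      · apply Continuous.intervalIntegrable; fun_prop
      · intro x hx
        have hx0 : 0 ≤ x := by have := hx.1; linarith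
        refine (abs_add_le _ _).trans (add_le_add ?_ ?_)
        · rw [abs_mul]
          have := L.bound (x := y * x) (by positivity)
          rw [hB] at this
          exact mul_le_mul (hK1 x hx) this (abs_nonneg _) hK0
        · rw [abs_mul, abs_mul, abs_of_nonneg hy, mul_comm _ y]
          exact mul_le_mul_of_nonneg_right (hK x hx) (by positivity)
    refine h1.trans ?_
    rw [intervalIntegral.integral_add (by simp) (by apply Continuous.intervalIntegrable; fun_prop),
      intervalIntegral.integral_const, intervalIntegral.integral_const_mul, intervalIntegral.integral_const_mul,
      intervalIntegral.mul_integral_comp_mul_left (f := fun x => |lf1 d m x|), smul_eq_mul]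
    gcongr
    rcases hy.eq_or_lt with h | h
    · rw [← h]
      simp only [zero_mul, intervalIntegral.integral_same, mul_zero, Real.sqrt_zero, ite_self, add_zero]
      positivity
    · have := L.var (a := y * (1/2)) (b := y * 4) (by positivity) (by linarith)
      rw [hB] at this
      have e1 : y * (1/2) = y / 2 := by ring
      have e2 : y * 4 = 4 * y := by ring
      rw [e1, e2] at this ⊢
      exact this
  refine key.trans ?_
  refine div_le_div_of_nonneg_right ?_ (Real.sqrt_nonneg _)
  have hX : 0 ≤ K * B * √M := by positivity
  split_ifs at V ⊢ <;> nlinarith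

lemma twosided (F : ℝ → ℂ) (hF : ∀ x, F x ≠ 0 → 1 / 2 ≤ |x| ∧ |x| ≤ 4) :
    ‖∫ x, F x‖ ≤ ‖∫ x in (1/2:ℝ)..4, F x‖ + ‖∫ x in (1/2:ℝ)..4, F (-x)‖ := by
  by_cases hi : Integrable F
  · have half : ∀ G : ℝ → ℂ, (∀ x, G x ≠ 0 → 1 / 2 ≤ |x| ∧ |x| ≤ 4) →
        ∫ x in Ioi (0:ℝ), G x = ∫ x in (1/2:ℝ)..4, G x := by
      intro G hG
      rw [intervalIntegral.integral_of_le (by norm_num), ← integral_Icc_eq_integral_Ioc]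
      apply setIntegral_eq_of_subset_of_forall_sdiff_eq_zero measurableSet_Ioi
      · intro x hx
        have := hx.1
        simp only [mem_Ioi]; linarith
      · intro x hx
        by_contra h
        have := hG x h
        rw [abs_of_pos hx.1] at this
        exact hx.2 this
    rw [← intervalIntegral.integral_Iic_add_Ioi (b := 0) hi.integrableOn hi.integrableOn]
    have h2 : ∫ x in Iic (0:ℝ), F x = ∫ x in Ioi (0:ℝ), F (-x) := by
      rw [integral_comp_neg_Ioi]; simp
    rw [h2, half F hF, half (fun x => F (-x)) (fun x hx => by simpa using hF (-x) hx), add_comm]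
    exact norm_add_le _ _
  · rw [integral_undef hi, norm_zero]; positivity

lemma Fterm_bound (d m : ℕ) {R : ℝ → ℝ} {β K : ℝ} {g1 : ℝ → ℝ} (hβ : 0 < β) (hβ1 : β < 1)
    (hRsupp : ∀ τ, R τ ≠ 0 → 1 / 2 ≤ |τ| ∧ |τ| ≤ 4)
    (hg : ∀ x, HasDerivAt (fun x => R x * x ^ (d+1)) (g1 x) x) (hcg : Continuous g1)
    (hK : ∀ x ∈ Icc (1/2:ℝ) 4, |R x * x ^ (d+1)| ≤ K) (hK1 : ∀ x ∈ Icc (1/2:ℝ) 4, |g1 x| ≤ K)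
    (j : ℤ) {t : ℝ} (ht : t ≠ 0) (z : Fin (d+1) → ℂ) (s : ℝ) :
    ‖Fterm (d+1) R (fun r => r ^ β) j t z s m‖ ≤
      2 * K * ((2:ℝ) ^ (2 * j)) ^ (d+2) / √(|t * (4 * (2:ℝ) ^ (2 * j)) ^ β| * (β * (1 - β) / 16)) *
       ((38 * √(2 * m + d + 1) + (if √((2:ℝ) ^ (2 * j) * hnormSq z / 2) ≤ 2 * m + d + 1 then
          6 * √((2:ℝ) ^ (2 * j) * hnormSq z / 2) else 0)) / (2 * m + d + 1) ^ 2) := by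
  have hh : 0 ≤ hnormSq z := Finset.sum_nonneg fun i _ => Complex.normSq_nonneg _
  set h := hnormSq z with hhd
  set q : ℝ := (2:ℝ) ^ (2 * j) with hq
  have hq0 : 0 < q := by positivity
  have hqi : (2:ℝ) ^ (-(2:ℤ) * j) = q⁻¹ := by rw [hq, ← zpow_neg]; congr 1; ring
  set M : ℝ := 2 * m + d + 1 with hM
  have hM1 : 1 ≤ M := (lagData d m).hM
  have hM0 : 0 < M := by linarith
  have hMc : 2 * (m:ℝ) + ((d + 1 : ℕ) : ℝ) = M := by rw [hM]; push_cast; ring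
  have hK0 : 0 ≤ K := (abs_nonneg _).trans (hK 1 ⟨by norm_num, by norm_num⟩)
  set B : ℝ := (Nat.choose (m+d) m : ℝ) with hBd
  have hB0 : 0 ≤ B := by positivity
  have hBM : B ≤ M ^ d := by
    have h1 : (m + d).choose m ≤ (m + d) ^ d := by
      rw [Nat.choose_symm_add]; exact Nat.choose_le_pow _ _
    calc B ≤ ((m + d : ℕ) : ℝ) ^ d := by rw [hBd]; exact_mod_cast h1
      _ ≤ M ^ d := by
        gcongr
        rw [hM]; push_cast
        have : (0:ℝ) ≤ m := by positivity
        linarith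
  set c : ℝ := q / M with hc
  have hc0 : 0 < c := by positivity
  set T : ℝ := t * (4 * q) ^ β with hT
  have hT0 : T ≠ 0 := mul_ne_zero ht (Real.rpow_pos_of_pos (by positivity) _).ne'
  set F : ℝ → ℂ := fun lam => Complex.exp (-(Complex.I * lam * s)) *
      Complex.exp (Complex.I * t * (((4 * (2 * (m : ℝ) + (d+1:ℕ)) * |lam|) ^ β : ℝ) : ℂ)) *
      ((R ((2 : ℝ) ^ (-(2 : ℤ) * j) * (2 * (m : ℝ) + (d+1:ℕ)) * |lam|) *
        laguerreL (d + 1 - 1) m (2 * |lam| * h) *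
        Real.exp (-(|lam| * h)) * |lam| ^ (d+1) : ℝ) : ℂ) with hF
  have e0 : Fterm (d+1) R (fun r => r ^ β) j t z s m = ∫ lam, F lam := rfl
  have e1 : ∫ lam, F lam = c • ∫ x, F (c * x) := by
    rw [Measure.integral_comp_mul_left, abs_inv, abs_of_pos hc0, smul_smul, mul_inv_cancel₀ hc0.ne', one_smul]
  have arg : ∀ x : ℝ, q⁻¹ * M * |c * x| = |x| := by
    intro x
    rw [abs_mul, abs_of_pos hc0, hc]
    field_simp
  have supp : ∀ x, F (c * x) ≠ 0 → 1 / 2 ≤ |x| ∧ |x| ≤ 4 := by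
    intro x hx
    have : R |x| ≠ 0 := by
      intro h0
      apply hx
      simp only [hF]
      rw [hqi, hMc, arg, h0]
      simp
    simpa using hRsupp _ this
  have formF : ∀ ε : ℝ, (ε = 1 ∨ ε = -1) → ∀ x ∈ Icc (1/2:ℝ) 4, F (c * (ε * x)) = ((c ^ (d+1) : ℝ) : ℂ) *
      (Complex.exp (Complex.I * ((T * x ^ β - (ε * c * s) * x : ℝ) : ℂ)) *
        (((R x * x ^ (d+1)) * lf d m ((2 * c * h) * x) : ℝ) : ℂ)) := by
    intro ε hε x hx
    have hx0 : 0 < x := by have := hx.1; linarith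
    have ax : |ε * x| = x := by
      rcases hε with h | h <;> simp [h, abs_of_pos hx0]
    have acx : |c * (ε * x)| = c * x := by rw [abs_mul, ax, abs_of_pos hc0]
    have e4 : (4 * M * (c * x)) ^ β = (4 * q) ^ β * x ^ β := by
      rw [← Real.mul_rpow (by positivity) hx0.le]
      congr 1
      rw [hc]; field_simp
    simp only [hF]
    rw [hqi, hMc, arg, acx, ax, e4, ← Complex.exp_add]
    have e5 : lf d m (2 * c * h * x) = laguerreL (d + 1 - 1) m (2 * (c * x) * h) * Real.exp (-(c * x * h)) := by
      rw [lf, lagP_eval]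
      congr 2 <;> [skip; skip] <;> ring_nf
    rw [e5]
    have e6 : -(Complex.I * ((c * (ε * x) : ℝ) : ℂ) * s) + Complex.I * t * (((4 * q) ^ β * x ^ β : ℝ) : ℂ)
        = Complex.I * ((T * x ^ β - (ε * c * s) * x : ℝ) : ℂ) := by
      rw [hT]; push_cast; ring
    rw [e6]
    push_cast
    ring
  have side : ∀ ε : ℝ, (ε = 1 ∨ ε = -1) → ‖∫ x in (1/2:ℝ)..4, F (c * (ε * x))‖ ≤ c ^ (d+1) *
      (K * B * (38 * √M + (if (2 * c * h) / 2 ≤ 2 * M then √(2 * M) * √(4 * (2 * c * h)) else 0))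
        / √(|T| * (β * (1 - β) / 16))) := by
    intro ε hε
    have : ∫ x in (1/2:ℝ)..4, F (c * (ε * x)) = ∫ x in (1/2:ℝ)..4, ((c ^ (d+1) : ℝ) : ℂ) *
      (Complex.exp (Complex.I * ((T * x ^ β - (ε * c * s) * x : ℝ) : ℂ)) *
        (((R x * x ^ (d+1)) * lf d m ((2 * c * h) * x) : ℝ) : ℂ)) := by
      apply intervalIntegral.integral_congr
      intro x hx
      rw [uIcc_of_le (by norm_num)] at hx
      exact formF ε hε x hx
    rw [this, intervalIntegral.integral_const_mul, norm_mul, Complex.norm_real, Real.norm_eq_abs,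
      abs_of_pos (by positivity)]
    gcongr
    exact onesided d m hβ hβ1 hT0 (by positivity) hg hcg hK hK1
  have tot : ‖Fterm (d+1) R (fun r => r ^ β) j t z s m‖ ≤ c * (2 * (c ^ (d+1) *
      (K * B * (38 * √M + (if (2 * c * h) / 2 ≤ 2 * M then √(2 * M) * √(4 * (2 * c * h)) else 0))
        / √(|T| * (β * (1 - β) / 16))))) := by
    rw [e0, e1, norm_smul, Real.norm_eq_abs, abs_of_pos hc0]
    gcongr
    have := twosided (fun x => F (c * x)) supp
    have s1 := side 1 (Or.inl rfl)
    have s2 := side (-1) (Or.inr rfl)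
    simp only [one_mul] at s1
    simp only [neg_one_mul] at s2
    linarith
  set A : ℝ := √(q * h / 2) with hA
  have hA0 : 0 ≤ A := Real.sqrt_nonneg _
  have hA2 : A ^ 2 = q * h / 2 := Real.sq_sqrt (by positivity)
  have ite1 : (if (2 * c * h) / 2 ≤ 2 * M then √(2 * M) * √(4 * (2 * c * h)) else 0) ≤
      (if A ≤ M then 6 * A else 0) := by
    have hch : c * h = 2 * A ^ 2 / M := by rw [hA2, hc]; field_simp
    have cond : (2 * c * h) / 2 ≤ 2 * M ↔ A ≤ M := by
      have : (2 * c * h) / 2 = 2 * A ^ 2 / M := by rw [← hch]; ring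
      rw [this, div_le_iff₀ hM0]
      constructor
      · intro h; nlinarith
      · intro h; nlinarith
    simp only [cond]
    split_ifs with h1
    · rw [← Real.sqrt_mul (by positivity)]
      apply Real.sqrt_le_iff.mpr ⟨by positivity, ?_⟩
      have : 2 * M * (4 * (2 * c * h)) = 32 * A ^ 2 := by
        have : 2 * M * (4 * (2 * c * h)) = 16 * M * (c * h) := by ring
        rw [this, hch]; field_simp; ring
      rw [this]; nlinarith [sq_nonneg A]
    · exact le_rfl
  have it0 : 0 ≤ (if A ≤ M then 6 * A else 0) := by split_ifs <;> positivity
  refine tot.trans ?_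
  set S := √(|T| * (β * (1 - β) / 16)) with hS
  have hS0 : 0 ≤ S := Real.sqrt_nonneg _
  calc _ ≤ c * (2 * (c ^ (d+1) * (K * M ^ d * (38 * √M + (if A ≤ M then 6 * A else 0)) / S))) := by
        gcongr
    _ = _ := by
        rw [hc, div_pow]
        field_simp
        try ring

lemma tele (A : ℝ) (hA : 0 ≤ A) :
    HasSum (fun m : ℕ => 4 * A * (1 / ((m:ℝ) + A) - 1 / ((m:ℝ) + 1 + A))) (if A = 0 then 0 else 4) := by
  split_ifs with h
  · subst h; simpa using (hasSum_zero : HasSum (fun _ : ℕ => (0:ℝ)) 0)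
  · have hA' : 0 < A := lt_of_le_of_ne hA (Ne.symm h)
    have nn : ∀ m : ℕ, 0 ≤ 4 * A * (1 / ((m:ℝ) + A) - 1 / ((m:ℝ) + 1 + A)) := by
      intro m
      have : 1 / ((m:ℝ) + 1 + A) ≤ 1 / ((m:ℝ) + A) := by
        apply one_div_le_one_div_of_le (by positivity); linarith
      have : 0 ≤ 1 / ((m:ℝ) + A) - 1 / ((m:ℝ) + 1 + A) := by linarith
      positivity
    rw [hasSum_iff_tendsto_nat_of_nonneg nn]
    have e : ∀ k : ℕ, ∑ i ∈ Finset.range k, 4 * A * (1 / ((i:ℝ) + A) - 1 / ((i:ℝ) + 1 + A))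
        = 4 * A * (1 / A - 1 / ((k:ℝ) + A)) := by
      intro k
      rw [← Finset.mul_sum]
      have := Finset.sum_range_sub' (fun i : ℕ => 1 / ((i:ℝ) + A)) k
      simp only [Nat.cast_add, Nat.cast_one, Nat.cast_zero, zero_add] at this
      rw [this]
    simp_rw [e]
    have lim : Filter.Tendsto (fun k : ℕ => 1 / ((k:ℝ) + A)) Filter.atTop (nhds 0) := by
      have : Filter.Tendsto (fun k : ℕ => (k:ℝ) + A) Filter.atTop Filter.atTop :=
        Filter.tendsto_atTop_add_const_right _ _ tendsto_natCast_atTop_atTop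
      simp only [one_div]
      exact this.inv_tendsto_atTop
    have := (lim.const_sub (1/A)).const_mul (4 * A)
    convert this using 2
    field_simp
    try ring

lemma termcmp (d m : ℕ) (A : ℝ) (hA : 0 ≤ A) :
    (38 * √(2 * m + d + 1) + (if A ≤ 2 * (m:ℝ) + d + 1 then 6 * A else 0)) / (2 * (m:ℝ) + d + 1) ^ 2 ≤
     38 * (1 / |(m:ℝ) + 1| ^ (3/2 : ℝ)) + 6 * (4 * A * (1 / ((m:ℝ) + A) - 1 / ((m:ℝ) + 1 + A))) := by
  have hm : (0:ℝ) ≤ m := by positivity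
  have hd : (0:ℝ) ≤ d := by positivity
  set M : ℝ := 2 * m + d + 1 with hM
  have hMm : (m:ℝ) + 1 ≤ M := by linarith
  have hM0 : 0 < M := by linarith
  rw [add_div]
  apply add_le_add
  · rw [mul_div_assoc]
    apply mul_le_mul_of_nonneg_left _ (by norm_num)
    have : √M / M ^ 2 = 1 / M ^ (3/2 : ℝ) := by
      rw [Real.sqrt_eq_rpow, ← Real.rpow_natCast, ← Real.rpow_sub hM0, one_div (M ^ (3/2:ℝ)), ← Real.rpow_neg hM0.le]
      norm_num
    rw [this, abs_of_pos (by positivity)]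
    apply one_div_le_one_div_of_le (by positivity)
    exact Real.rpow_le_rpow (by positivity) hMm (by norm_num)
  · rcases hA.eq_or_lt with h | h
    · subst h; simp
    · have e : 1 / ((m:ℝ) + A) - 1 / ((m:ℝ) + 1 + A) = 1 / ((m + A) * (m + 1 + A)) := by
        field_simp; ring
      rw [e]
      split_ifs with h1
      · have : 6 * (4 * A * (1 / ((m + A) * (m + 1 + A)))) = 6 * A * 4 / ((m + A) * (m + 1 + A)) := by ring
        rw [this, div_le_div_iff₀ (by positivity) (by positivity)]
        have : (m + A) * (m + 1 + A) ≤ 4 * M ^ 2 := by nlinarith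
        nlinarith
      · rw [zero_div]; positivity

end main
/-- Decay estimate for the frequency-localized half-wave propagator
(`φ(r) = r^{α/2}`, `0 < α < 2`) associated with the fractional wave equation:
`|F_j^φ(t,z,s)| ≤ C |t|^{-1/2} 2^{j(N-α/2)}` for all `j ∈ ℤ`, `t ≠ 0`, `N = 2n+2`. -/
theorem statement16 (n : ℕ) (hn : 1 ≤ n) (α : ℝ) (hα0 : 0 < α) (hα2 : α < 2)
    (R : ℝ → ℝ) (hRsm : ContDiff ℝ (⊤ : ℕ∞) R) (hRcs : HasCompactSupport R)
    (hRev : ∀ τ, R (-τ) = R τ) (hRpos : ∀ τ, 0 ≤ R τ)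
    (hRsupp : ∀ τ, R τ ≠ 0 → 1 / 2 ≤ |τ| ∧ |τ| ≤ 4)
    (hRsum : ∀ τ : ℝ, τ ≠ 0 → HasSum (fun j : ℤ => R ((2 : ℝ) ^ (-(2 : ℤ) * j) * τ)) 1) :
    ∃ C : ℝ, 0 < C ∧ ∀ j : ℤ, ∀ t : ℝ, t ≠ 0 → ∀ (z : Fin n → ℂ) (s : ℝ),
      ‖Fkernel n R (fun r => r ^ (α / 2)) j t z s‖ ≤
        C * |t| ^ (-(1 / 2) : ℝ) * (2 : ℝ) ^ ((j : ℝ) * ((2 * (n : ℝ) + 2) - α / 2)) := by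
  obtain ⟨d, rfl⟩ : ∃ d, n = d + 1 := ⟨n - 1, by omega⟩
  set β := α / 2 with hβd
  have hβ : 0 < β := by positivity
  have hβ1 : β < 1 := by rw [hβd]; linarith
  have hcd : ContDiff ℝ 1 (fun x => R x * x ^ (d+1)) :=
    ((hRsm.of_le (by exact_mod_cast le_top)).mul (contDiff_id.pow _))
  have hg : ∀ x, HasDerivAt (fun x => R x * x ^ (d+1)) (deriv (fun x => R x * x ^ (d+1)) x) x :=
    fun x => (hcd.differentiable (by norm_num) x).hasDerivAt
  have hcg : Continuous (deriv (fun x => R x * x ^ (d+1))) := hcd.continuous_deriv (by norm_num)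
  obtain ⟨K1, hK1⟩ := (isCompact_Icc (a := (1/2:ℝ)) (b := 4)).exists_bound_of_continuousOn hcd.continuous.continuousOn
  obtain ⟨K2, hK2⟩ := (isCompact_Icc (a := (1/2:ℝ)) (b := 4)).exists_bound_of_continuousOn hcg.continuousOn
  set K := max (max K1 K2) 1 with hK
  have hK0 : 0 < K := lt_of_lt_of_le one_pos (le_max_right _ _)
  have hKa : ∀ x ∈ Set.Icc (1/2:ℝ) 4, |R x * x ^ (d+1)| ≤ K := fun x hx =>
    (hK1 x hx).trans ((le_max_left _ _).trans (le_max_left _ _))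
  have hKb : ∀ x ∈ Set.Icc (1/2:ℝ) 4, |deriv (fun x => R x * x ^ (d+1)) x| ≤ K := fun x hx =>
    (hK2 x hx).trans ((le_max_right _ _).trans (le_max_left _ _))
  have hZ : Summable (fun m : ℕ => 1 / |(m:ℝ) + 1| ^ (3/2 : ℝ)) :=
    (Real.summable_one_div_nat_add_rpow 1 (3/2)).mpr (by norm_num)
  set Z := ∑' m : ℕ, 1 / |(m:ℝ) + 1| ^ (3/2 : ℝ) with hZd
  have hZ0 : 0 ≤ Z := tsum_nonneg fun m => by positivity
  have hb1 : 0 < 1 - β := by linarith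
  set P : ℝ := 2 ^ (d + 1 - 1) / Real.pi ^ (d + 1 + 1) with hP
  have hP0 : 0 < P := by have := Real.pi_pos; positivity
  set W : ℝ := √((4:ℝ) ^ β * (β * (1 - β) / 16)) with hW
  have hW0 : 0 < W := by
    apply Real.sqrt_pos.mpr
    positivity
  refine ⟨P * (2 * K / W * (38 * Z + 24)), by positivity, ?_⟩
  intro j t ht z s
  set q : ℝ := (2:ℝ) ^ (2 * j) with hq
  have hq0 : 0 < q := by positivity
  set A := √(q * hnormSq z / 2) with hA
  have hA0 : 0 ≤ A := Real.sqrt_nonneg _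
  set Q : ℝ := 2 * K * q ^ (d+2) / √(|t * (4 * q) ^ β| * (β * (1 - β) / 16)) with hQ
  have hQ0 : 0 ≤ Q := by positivity
  have hs := ((hZ.hasSum.mul_left 38).add ((tele A hA0).mul_left 6)).mul_left Q
  have hb := tsum_of_norm_bounded hs (f := fun m => Fterm (d+1) R (fun r => r ^ β) j t z s m) (fun m =>
    (Fterm_bound d m hβ hβ1 hRsupp hg hcg hKa hKb j ht z s).trans
      (mul_le_mul_of_nonneg_left (termcmp d m A hA0) hQ0))
  have hit : 6 * (if A = 0 then (0:ℝ) else 4) ≤ 24 := by split_ifs <;> norm_num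
  have ht0 : 0 < |t| := abs_pos.mpr ht
  have hQe : Q = 2 * K / W * (|t| ^ (-(1/2) : ℝ) * (2:ℝ) ^ ((j:ℝ) * ((2 * ((d+1:ℕ):ℝ) + 2) - β))) := by
    have e1 : |t * (4 * q) ^ β| * (β * (1 - β) / 16) = |t| * q ^ β * ((4:ℝ) ^ β * (β * (1 - β) / 16)) := by
      rw [abs_mul, abs_of_pos (Real.rpow_pos_of_pos (by positivity) β), Real.mul_rpow (by norm_num) hq0.le]
      ring
    have e2 : √(|t| * q ^ β * ((4:ℝ) ^ β * (β * (1 - β) / 16))) = |t| ^ (1/2 : ℝ) * q ^ (β / 2) * W := by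
      rw [Real.sqrt_mul (by positivity), Real.sqrt_mul (by positivity), ← hW, Real.sqrt_eq_rpow,
        Real.sqrt_eq_rpow, ← Real.rpow_mul hq0.le]
      congr 3
      ring
    have hqr : q = (2:ℝ) ^ (2 * (j:ℝ)) := by
      rw [hq, ← Real.rpow_intCast]; push_cast; rfl
    have e3 : (2:ℝ) ^ ((j:ℝ) * ((2 * ((d+1:ℕ):ℝ) + 2) - β)) = q ^ (d+2) / q ^ (β / 2) := by
      rw [← Real.rpow_natCast q, ← Real.rpow_sub hq0, hqr, ← Real.rpow_mul (by norm_num)]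
      congr 1
      push_cast
      ring
    rw [hQ, e1, e2, e3, Real.rpow_neg ht0.le]
    have : 0 < |t| ^ (1/2:ℝ) := by positivity
    have : 0 < q ^ (β/2) := by positivity
    field_simp
  have hfin : ‖Fkernel (d+1) R (fun r => r ^ β) j t z s‖ ≤ P * (Q * (38 * Z + 24)) := by
    rw [Fkernel, norm_mul, Complex.norm_real, Real.norm_eq_abs, abs_of_pos hP0]
    apply mul_le_mul_of_nonneg_left _ hP0.le
    refine hb.trans (mul_le_mul_of_nonneg_left ?_ hQ0)
    linarith
  refine hfin.trans (le_of_eq ?_)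
  rw [hQe]
  ring
end

section
/- Let n ≥ 1 and 0 < α < 2, and set s₀ = (α/2)·(4n)^{α/2}. Then there exists ε ∈ (0,1) such that for every smooth compactly supported Q : ℝ → ℝ with support contained in (1−ε, 1+ε) and Q(1) = 1, there exist constants c₁, c₂, T > 0 such that for all t ≥ T, c₁ t^{−1/2} ≤ | ∫_ℝ e^{i t (−λ s₀ + (4nλ)^{α/2})} Q(λ) λ^n dλ | ≤ c₂ t^{−1/2}. (This shows the decay rate |t|^{−1/2} for the half-wave propagator e^{it𝓛^{α/2}} on the Heisenberg group is sharp.) -/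
open MeasureTheory

lemma ibp (θ θ1 θ2 A A1 : ℝ → ℝ) (t m K M p q : ℝ) (ht : 0 < t) (hm : 0 < m) (hp : 0 < p)
    (hpq : p ≤ q) (hM : 0 ≤ M) (hK : 0 ≤ K) (hθc : Continuous θ) (hAc : Continuous A)
    (hθ : ∀ x ∈ Set.Icc p q, HasDerivAt θ (θ1 x) x)
    (hθ1 : ∀ x ∈ Set.Icc p q, HasDerivAt θ1 (θ2 x) x)
    (hA : ∀ x ∈ Set.Icc p q, HasDerivAt A (A1 x) x)
    (b1 : ∀ x ∈ Set.Icc p q, m * x ≤ |θ1 x|)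
    (b2 : ∀ x ∈ Set.Icc p q, |θ2 x| ≤ K)
    (b3 : ∀ x ∈ Set.Icc p q, |A x| ≤ M)
    (b4 : ∀ x ∈ Set.Icc p q, |A1 x| ≤ M / x) :
    ‖∫ x in p..q, Complex.exp (Complex.I * t * (θ x : ℝ)) * (A x : ℝ)‖ ≤
      (3 * (M / m) + M * K / m ^ 2) / (t * p) := by
  set f : ℝ → ℂ := fun x => Complex.exp (Complex.I * t * (θ x : ℝ)) * (A x : ℝ) with hf
  have hfc : Continuous f := by fun_prop
  have hE : ∀ x, ‖Complex.exp (Complex.I * t * (θ x : ℝ))‖ = 1 := by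
    intro x
    rw [Complex.norm_exp]; simp
  set G : ℝ → ℂ := fun x => Complex.exp (Complex.I * t * (θ x : ℝ)) *
    ((A x / θ1 x : ℝ) : ℂ) / (Complex.I * t) with hG
  have hpos : ∀ x ∈ Set.Icc p q, 0 < x := fun x hx => lt_of_lt_of_le hp hx.1
  have hθ1pos : ∀ x ∈ Set.Icc p q, 0 < |θ1 x| := fun x hx =>
    lt_of_lt_of_le (mul_pos hm (hpos x hx)) (b1 x hx)
  have hθ1ne : ∀ x ∈ Set.Icc p q, θ1 x ≠ 0 := fun x hx => abs_pos.1 (hθ1pos x hx)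
  have htc : (t : ℂ) ≠ 0 := by exact_mod_cast ht.ne'
  set R : ℝ → ℂ := fun x => Complex.exp (Complex.I * t * (θ x : ℝ)) *
    (((A1 x * θ1 x - A x * θ2 x) / (θ1 x) ^ 2 : ℝ) : ℂ) / (Complex.I * t) with hR
  have hGd : ∀ x ∈ Set.Icc p q, HasDerivAt G (f x + R x) x := by
    intro x hx
    have h1 := ((hθ x hx).ofReal_comp.const_mul (Complex.I * t)).cexp
    have h2 := ((hA x hx).div (hθ1 x hx) (hθ1ne x hx)).ofReal_comp
    have h3 := (h1.mul h2).div_const (Complex.I * t)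
    refine h3.congr_deriv ?_
    have : (θ1 x : ℂ) ≠ 0 := by exact_mod_cast hθ1ne x hx
    simp only [hf, hR, Pi.div_apply]
    push_cast
    field_simp
  have hGn : ∀ x ∈ Set.Icc p q, ‖G x‖ ≤ M / m / (t * p) := by
    intro x hx
    simp only [hG]
    rw [norm_div, norm_mul, norm_mul, hE, Complex.norm_I, Complex.norm_real, Complex.norm_real,
      Real.norm_eq_abs, Real.norm_eq_abs, abs_of_pos ht, one_mul, one_mul]
    have : |A x| / |θ1 x| ≤ M / (m * p) := by
      apply div_le_div₀ hM (b3 x hx) (by positivity)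
      exact le_trans (by gcongr; exact hx.1) (b1 x hx)
    calc |A x / θ1 x| / t ≤ M / (m * p) / t := by rw [abs_div]; gcongr
      _ = M / m / (t * p) := by field_simp
  set D := M / m + M * K / m ^ 2 with hD
  have hRn : ∀ x ∈ Set.Icc p q, ‖R x‖ ≤ D / t * (x ^ 2)⁻¹ := by
    intro x hx
    have hx0 := hpos x hx
    simp only [hR]
    rw [norm_div, norm_mul, norm_mul, hE, Complex.norm_I, Complex.norm_real, Complex.norm_real,
      Real.norm_eq_abs, Real.norm_eq_abs, abs_of_pos ht, one_mul, one_mul]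
    have e : (A1 x * θ1 x - A x * θ2 x) / (θ1 x) ^ 2 = A1 x / θ1 x - A x * θ2 x / θ1 x ^ 2 := by
      have := hθ1ne x hx
      field_simp
    have e1 : |A1 x / θ1 x| ≤ (M / x) / (m * x) := by
      rw [abs_div]
      exact div_le_div₀ (by positivity) (b4 x hx) (by positivity) (b1 x hx)
    have e2 : |A x * θ2 x / θ1 x ^ 2| ≤ M * K / (m * x) ^ 2 := by
      rw [abs_div, abs_mul, abs_pow]
      apply div_le_div₀ (by positivity) _ (by positivity) _
      · exact mul_le_mul (b3 x hx) (b2 x hx) (abs_nonneg _) hM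
      · exact pow_le_pow_left₀ (by positivity) (b1 x hx) 2
    rw [e]
    calc _ ≤ ((M / x) / (m * x) + M * K / (m * x) ^ 2) / t := by
          gcongr
          exact (abs_sub _ _).trans (add_le_add e1 e2)
      _ = _ := by rw [hD]; field_simp
  have hFd : ∀ x, HasDerivAt (fun y => ∫ u in p..y, f u) (f x) x := fun x =>
    intervalIntegral.integral_hasDerivAt_right (hfc.intervalIntegrable _ _)
      (hfc.stronglyMeasurableAtFilter _ _) hfc.continuousAt
  have key := image_norm_le_of_norm_deriv_right_le_deriv_boundary' (a := p) (b := q)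
    (f := fun y => (∫ u in p..y, f u) - (G y - G p)) (f' := fun x => - R x)
    (B := fun x => D / t * (p⁻¹ - x⁻¹)) (B' := fun x => D / t * (x ^ 2)⁻¹)
    (fun x hx => ((hFd x).sub ((hGd x hx).sub_const _)).continuousAt.continuousWithinAt)
    (fun x hx => (((hFd x).sub ((hGd x ⟨hx.1, hx.2.le⟩).sub_const _)).congr_deriv
      (by ring)).hasDerivWithinAt)
    (by simp)
    (fun x hx => (((hasDerivAt_inv (hpos x hx).ne').const_sub _).const_mul _).continuousAt.continuousWithinAt)
    (fun x hx => ((((hasDerivAt_inv (hpos x ⟨hx.1, hx.2.le⟩).ne').const_sub _).const_mul _).congr_deriv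
      (by ring)).hasDerivWithinAt)
    (fun x hx => by rw [norm_neg]; exact hRn x ⟨hx.1, hx.2.le⟩)
    (Set.right_mem_Icc.2 hpq)
  have hq : 0 < q := hp.trans_le hpq
  have hD0 : 0 ≤ D := by positivity
  calc ‖∫ x in p..q, f x‖ = ‖((∫ u in p..q, f u) - (G q - G p)) + G q - G p‖ := by congr 1; ring
    _ ≤ ‖((∫ u in p..q, f u) - (G q - G p))‖ + ‖G q‖ + ‖G p‖ :=
        (norm_sub_le _ _).trans (by gcongr; exact norm_add_le _ _)
    _ ≤ D / t * (p⁻¹ - q⁻¹) + M / m / (t * p) + M / m / (t * p) := by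
        gcongr
        · exact hGn q (Set.right_mem_Icc.2 hpq)
        · exact hGn p (Set.left_mem_Icc.2 hpq)
    _ ≤ D / t * p⁻¹ + M / m / (t * p) + M / m / (t * p) := by
        gcongr
        have : 0 < q⁻¹ := by positivity
        linarith
    _ = _ := by rw [hD]; field_simp; ring

lemma gtail (c : ℝ) (hc : 0 < c) : ∃ C : ℝ, 0 ≤ C ∧ ∀ t p : ℝ, 0 < t → 0 < p →
    ‖∫ x in Set.Ioi p, Complex.exp (-(1 + Complex.I * c * t) * (x : ℂ) ^ 2)‖ ≤ C / (t * p) := by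
  refine ⟨3 * (1 / (2 * c)) + 1 * (2 * c) / (2 * c) ^ 2, by positivity, fun t p ht hp => ?_⟩
  have hint : Integrable (fun x : ℝ => Complex.exp (-(1 + Complex.I * c * t) * (x : ℂ) ^ 2)) :=
    integrable_cexp_neg_mul_sq (by simp)
  have hlim := intervalIntegral_tendsto_integral_Ioi p hint.integrableOn Filter.tendsto_id
  refine le_of_tendsto hlim.norm ?_
  filter_upwards [Filter.eventually_ge_atTop p] with q hq
  have := ibp (fun x => -c * x ^ 2) (fun x => -(2 * c) * x) (fun _ => -(2 * c))
    (fun x => Real.exp (-x ^ 2)) (fun x => Real.exp (-x ^ 2) * (-(2 * x))) t (2 * c) (2 * c) 1 p q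
    ht (by positivity) hp hq (by positivity) (by positivity) (by fun_prop) (by fun_prop)
    (fun x _ => ((hasDerivAt_pow 2 x).const_mul _).congr_deriv (by simp; ring))
    (fun x _ => ((hasDerivAt_id x).const_mul _).congr_deriv (by simp))
    (fun x _ => ((hasDerivAt_pow 2 x).neg.exp).congr_deriv (by simp))
    (fun x hx => by
      have : 0 < x := hp.trans_le hx.1
      rw [abs_mul, abs_neg, abs_of_pos this, abs_of_pos (by positivity)])
    (fun x hx => by rw [abs_neg, abs_of_pos (by positivity)])
    (fun x hx => by
      rw [abs_of_pos (Real.exp_pos _), Real.exp_le_one_iff]; nlinarith [sq_nonneg x])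
    (fun x hx => by
      have h0 : 0 < x := hp.trans_le hx.1
      rw [abs_mul, abs_neg, abs_of_pos (Real.exp_pos _), abs_of_pos (by positivity),
        Real.exp_neg, inv_mul_eq_div, div_le_div_iff₀ (Real.exp_pos _) h0]
      have h1 := Real.quadratic_le_exp_of_nonneg (sq_nonneg x)
      nlinarith [sq_nonneg (x ^ 2 - 1)])
  refine le_trans (le_of_eq ?_) this
  congr 1
  apply intervalIntegral.integral_congr
  intro x _
  push_cast
  rw [← Complex.exp_add]
  congr 1
  ring

lemma half (θ θ1 θ2 θ3 A A1 : ℝ → ℝ) (m K M c : ℝ) (hm : 0 < m) (hK : 0 ≤ K)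
    (hM : 0 ≤ M) (hc : 0 < c) (hθc : Continuous θ) (hAc : Continuous A)
    (hθ : ∀ x ∈ Set.Icc (0:ℝ) (1/2), HasDerivAt θ (θ1 x) x)
    (hθ1 : ∀ x ∈ Set.Icc (0:ℝ) (1/2), HasDerivAt θ1 (θ2 x) x)
    (hθ2 : ∀ x ∈ Set.Icc (0:ℝ) (1/2), HasDerivAt θ2 (θ3 x) x)
    (hA : ∀ x ∈ Set.Icc (0:ℝ) (1/2), HasDerivAt A (A1 x) x)
    (b2 : ∀ x ∈ Set.Icc (0:ℝ) (1/2), θ2 x ≤ -m)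
    (b3 : ∀ x ∈ Set.Icc (0:ℝ) (1/2), |θ3 x| ≤ K)
    (bA : ∀ x ∈ Set.Icc (0:ℝ) (1/2), |A x| ≤ M)
    (bA1 : ∀ x ∈ Set.Icc (0:ℝ) (1/2), |A1 x| ≤ M)
    (z0 : θ 0 = 0) (z1 : θ1 0 = 0) (z2 : θ2 0 = -(2 * c)) (zA : A 0 = 1) :
    ∃ C : ℝ, 0 ≤ C ∧ ∀ t d : ℝ, 0 < t → 0 < d → d ≤ 1/2 →
      ‖(∫ x in (0:ℝ)..(1/2), Complex.exp (Complex.I * t * (θ x : ℝ)) * (A x : ℝ)) -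
        (Real.pi / (1 + Complex.I * c * t)) ^ (1 / 2 : ℂ) / 2‖ ≤
        C * (t * d ^ 4 + d ^ 2 + 1 / (t * d)) := by
  -- mean value bounds
  have mv : ∀ (f f' : ℝ → ℝ) (L : ℝ) (k : ℕ), 0 ≤ L →
      (∀ x ∈ Set.Icc (0:ℝ) (1/2), HasDerivAt f (f' x) x) →
      (∀ x ∈ Set.Icc (0:ℝ) (1/2), |f' x| ≤ L * x ^ k) → f 0 = 0 →
      ∀ x ∈ Set.Icc (0:ℝ) (1/2), |f x| ≤ L * x ^ (k + 1) := by
    intro f f' L k hL hf hb h0 x hx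
    have hsub : ∀ y ∈ Set.Icc (0:ℝ) x, y ∈ Set.Icc (0:ℝ) (1/2) := fun y hy =>
      ⟨hy.1, hy.2.trans hx.2⟩
    have := norm_image_sub_le_of_norm_deriv_le_segment' (f := f) (f' := f') (a := 0) (b := x)
      (C := L * x ^ k)
      (fun y hy => (hf y (hsub y hy)).hasDerivWithinAt)
      (fun y hy => (hb y (hsub y ⟨hy.1, hy.2.le⟩)).trans (by
        have h1 := hy.1
        have h2 := hy.2.le
        gcongr))
      x ⟨hx.1, le_refl x⟩
    rw [h0, sub_zero, sub_zero, Real.norm_eq_abs] at this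
    rw [pow_succ]; linarith
  have e2 : ∀ x ∈ Set.Icc (0:ℝ) (1/2), |θ2 x + 2 * c| ≤ K * x ^ (0 + 1) :=
    mv (fun x => θ2 x + 2 * c) θ3 K 0 hK (fun x hx => (hθ2 x hx).add_const _)
      (by simpa using b3) (by simp [z2])
  have e1 : ∀ x ∈ Set.Icc (0:ℝ) (1/2), |θ1 x + 2 * c * x| ≤ K * x ^ (0 + 1 + 1) :=
    mv (fun x => θ1 x + 2 * c * x) (fun x => θ2 x + 2 * c) K (0 + 1) hK
      (fun x hx => ((hθ1 x hx).add ((hasDerivAt_id x).const_mul (2 * c))).congr_deriv (by simp))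
      e2 (by simp [z1])
  have e0 : ∀ x ∈ Set.Icc (0:ℝ) (1/2), |θ x + c * x ^ 2| ≤ K * x ^ (0 + 1 + 1 + 1) :=
    mv (fun x => θ x + c * x ^ 2) (fun x => θ1 x + 2 * c * x) K (0 + 1 + 1) hK
      (fun x hx => ((hθ x hx).add ((hasDerivAt_pow 2 x).const_mul c)).congr_deriv (by simp; ring))
      e1 (by simp [z0])
  have eA : ∀ x ∈ Set.Icc (0:ℝ) (1/2), |A x - 1| ≤ M * x ^ (0 + 1) :=
    mv (fun x => A x - 1) A1 M 0 hM (fun x hx => (hA x hx).sub_const _)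
      (by simpa using bA1) (by simp [zA])
  have l1 : ∀ x ∈ Set.Icc (0:ℝ) (1/2), m * x ≤ |θ1 x| := by
    intro x hx
    rcases eq_or_lt_of_le hx.1 with h | h
    · simp [← h]
    · have hsub : ∀ y ∈ Set.Icc (0:ℝ) x, y ∈ Set.Icc (0:ℝ) (1/2) := fun y hy =>
        ⟨hy.1, hy.2.trans hx.2⟩
      obtain ⟨y, hy, hy2⟩ := exists_hasDerivAt_eq_slope θ1 θ2 h
        (fun y hy => (hθ1 y (hsub y hy)).continuousAt.continuousWithinAt)
        (fun y hy => hθ1 y (hsub y ⟨hy.1.le, hy.2.le⟩))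
      have h3 := b2 y (hsub y ⟨hy.1.le, hy.2.le⟩)
      rw [hy2, z1, sub_zero, sub_zero, div_le_iff₀ h] at h3
      have := neg_le_abs (θ1 x)
      linarith
  have u2 : ∀ x ∈ Set.Icc (0:ℝ) (1/2), |θ2 x| ≤ K + 2 * c := by
    intro x hx
    have h := abs_le.1 (e2 x hx)
    have : K * x ^ (0 + 1) ≤ K := by
      rw [zero_add, pow_one]; nlinarith [hx.2]
    rw [abs_le]; constructor <;> linarith [h.1, h.2]
  obtain ⟨Cg, hCg, hg⟩ := gtail c hc
  set C1 := 3 * (M / m) + M * (K + 2 * c) / m ^ 2 with hC1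
  have hC10 : 0 ≤ C1 := by positivity
  refine ⟨K * M + (M + 1) + C1 + Cg, by positivity, fun t d ht hd hd2 => ?_⟩
  have hb : 0 < (1 + Complex.I * c * t).re := by simp
  rw [← integral_gaussian_complex_Ioi hb]
  set g : ℝ → ℂ := fun x : ℝ => Complex.exp (-(1 + Complex.I * c * t) * (x : ℂ) ^ 2) with hgdef
  set f : ℝ → ℂ := fun x => Complex.exp (Complex.I * t * (θ x : ℝ)) * (A x : ℝ) with hf
  have hfc : Continuous f := by fun_prop
  have hgc : Continuous g := by fun_prop
  have hgint : Integrable g := integrable_cexp_neg_mul_sq hb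
  have s1 : ∫ x in (0:ℝ)..(1/2), f x = (∫ x in (0:ℝ)..d, f x) + ∫ x in d..(1/2), f x :=
    (intervalIntegral.integral_add_adjacent_intervals (hfc.intervalIntegrable _ _)
      (hfc.intervalIntegrable _ _)).symm
  have s2 : ∫ x in Set.Ioi (0:ℝ), g x = (∫ x in (0:ℝ)..d, g x) + ∫ x in Set.Ioi d, g x :=
    (intervalIntegral.integral_interval_add_Ioi hgint.integrableOn hgint.integrableOn).symm
  have t1 : ‖∫ x in d..(1/2), f x‖ ≤ C1 / (t * d) := by
    have hsub : ∀ y ∈ Set.Icc d (1/2), y ∈ Set.Icc (0:ℝ) (1/2) := fun y hy =>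
        ⟨hd.le.trans hy.1, hy.2⟩
    exact ibp θ θ1 θ2 A A1 t m (K + 2 * c) M d (1/2) ht hm hd hd2 hM (by positivity) hθc hAc
      (fun x hx => hθ x (hsub x hx)) (fun x hx => hθ1 x (hsub x hx))
      (fun x hx => hA x (hsub x hx)) (fun x hx => l1 x (hsub x hx))
      (fun x hx => u2 x (hsub x hx)) (fun x hx => bA x (hsub x hx))
      (fun x hx => (bA1 x (hsub x hx)).trans (by
        have : 0 < x := hd.trans_le hx.1
        rw [le_div_iff₀ this]
        nlinarith [hx.2]))
  have t2 : ‖∫ x in Set.Ioi d, g x‖ ≤ Cg / (t * d) := hg t d ht hd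
  have t3 : ‖(∫ x in (0:ℝ)..d, f x) - ∫ x in (0:ℝ)..d, g x‖ ≤
      (t * K * M * d ^ 3 + (M + 1) * d) * d := by
    rw [← intervalIntegral.integral_sub (hfc.intervalIntegrable _ _) (hgc.intervalIntegrable _ _)]
    have := intervalIntegral.norm_integral_le_of_norm_le_const (a := 0) (b := d)
      (f := fun x => f x - g x) (C := t * K * M * d ^ 3 + (M + 1) * d) ?_
    · rwa [sub_zero, abs_of_pos hd] at this
    · intro x hx
      rw [Set.uIoc_of_le hd.le] at hx
      have hx0 : 0 < x := hx.1
      have hx' : x ∈ Set.Icc (0:ℝ) (1/2) := ⟨hx.1.le, hx.2.trans hd2⟩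
      have hge : g x = Complex.exp (Complex.I * t * ((-(c * x ^ 2) : ℝ) : ℂ)) *
          ((Real.exp (-x ^ 2) : ℝ) : ℂ) := by
        simp only [hgdef]
        push_cast
        rw [← Complex.exp_add]
        congr 1
        ring
      have hn : ‖Complex.exp (Complex.I * t * ((-(c * x ^ 2) : ℝ) : ℂ))‖ = 1 := by
        rw [Complex.norm_exp]; simp [← Complex.ofReal_pow]
      have hdec : f x - g x = Complex.exp (Complex.I * t * ((-(c * x ^ 2) : ℝ) : ℂ)) *
          ((Complex.exp (Complex.I * ((t * (θ x + c * x ^ 2) : ℝ) : ℂ)) - 1) * (A x : ℝ) +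
            ((A x - Real.exp (-x ^ 2) : ℝ) : ℂ)) := by
        have : Complex.exp (Complex.I * t * (θ x : ℝ)) =
          Complex.exp (Complex.I * t * ((-(c * x ^ 2) : ℝ) : ℂ)) *
          Complex.exp (Complex.I * ((t * (θ x + c * x ^ 2) : ℝ) : ℂ)) := by
          rw [← Complex.exp_add]
          congr 1
          push_cast
          ring
        simp only [hf]
        rw [hge, this]
        push_cast
        ring
      rw [hdec, norm_mul, hn, one_mul]
      refine (norm_add_le _ _).trans ?_
      rw [norm_mul, Complex.norm_real, Complex.norm_real, Real.norm_eq_abs, Real.norm_eq_abs]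
      have q1 : ‖Complex.exp (Complex.I * ((t * (θ x + c * x ^ 2) : ℝ) : ℂ)) - 1‖ ≤
          t * (K * d ^ 3) := by
        refine Real.norm_exp_I_mul_ofReal_sub_one_le.trans ?_
        rw [Real.norm_eq_abs, abs_mul, abs_of_pos ht]
        gcongr
        refine (e0 x hx').trans ?_
        norm_num
        gcongr
        exact hx.2
      have q2 : |A x - Real.exp (-x ^ 2)| ≤ (M + 1) * d := by
        have h1 := abs_le.1 (eA x hx')
        have h2 := Real.add_one_le_exp (-x ^ 2)
        have h3 : Real.exp (-x ^ 2) ≤ 1 := by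
          rw [Real.exp_le_one_iff]; nlinarith [sq_nonneg x]
        have h4 : x ^ 2 ≤ d := by nlinarith [hx.2]
        have h5 : M * x ^ (0 + 1) ≤ M * d := by
          rw [zero_add, pow_one]; gcongr; exact hx.2
        rw [abs_le]
        constructor <;> linarith [h1.1, h1.2]
      have q3 : ‖Complex.exp (Complex.I * ((t * (θ x + c * x ^ 2) : ℝ) : ℂ)) - 1‖ * |A x| ≤
          t * (K * d ^ 3) * M := mul_le_mul q1 (bA x hx') (abs_nonneg _) (by positivity)
      linarith
  rw [s1, s2]
  calc _ = ‖((∫ x in (0:ℝ)..d, f x) - ∫ x in (0:ℝ)..d, g x) + (∫ x in d..(1/2), f x)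
        - ∫ x in Set.Ioi d, g x‖ := by congr 1; ring
    _ ≤ ‖(∫ x in (0:ℝ)..d, f x) - ∫ x in (0:ℝ)..d, g x‖ + ‖∫ x in d..(1/2), f x‖ +
        ‖∫ x in Set.Ioi d, g x‖ := (norm_sub_le _ _).trans (by gcongr; exact norm_add_le _ _)
    _ ≤ (t * K * M * d ^ 3 + (M + 1) * d) * d + C1 / (t * d) + Cg / (t * d) := by gcongr
    _ = K * M * (t * d ^ 4) + (M + 1) * d ^ 2 + (C1 + Cg) * (1 / (t * d)) := by ring
    _ ≤ _ := by
      have r1 : 0 ≤ t * d ^ 4 := by positivity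
      have r2 : 0 ≤ d ^ 2 := by positivity
      have r3 : 0 ≤ 1 / (t * d) := by positivity
      have r4 : 0 ≤ K * M := by positivity
      have r5 : 0 ≤ C1 + Cg := by positivity
      nlinarith [mul_nonneg r4 r2, mul_nonneg r4 r3, mul_nonneg hM r1, mul_nonneg hM r3,
        mul_nonneg r5 r1, mul_nonneg r5 r2]

lemma side (a β s : ℝ) (ha : 0 < a) (h0 : 0 < β) (h1 : β < 1) (hs : s = 1 ∨ s = -1)
    (B : ℝ → ℝ) (hB : ContDiff ℝ 1 B) (hB1 : B 1 = 1) :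
    ∃ C : ℝ, 0 ≤ C ∧ ∀ t d : ℝ, 0 < t → 0 < d → d ≤ 1/2 →
      ‖(∫ x in (0:ℝ)..(1/2), Complex.exp (Complex.I * t *
          ((a * ((1 + s * x) ^ β - β * (1 + s * x)) - a * (1 - β) : ℝ) : ℂ)) *
          (B (1 + s * x) : ℝ)) -
        (Real.pi / (1 + Complex.I * (a * β * (1 - β) / 2 : ℝ) * t)) ^ (1 / 2 : ℂ) / 2‖ ≤
        C * (t * d ^ 4 + d ^ 2 + 1 / (t * d)) := by
  have hs2 : s * s = 1 := by rcases hs with h | h <;> simp [h]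
  have hy : ∀ x ∈ Set.Icc (0:ℝ) (1/2), 1/2 ≤ 1 + s * x ∧ 1 + s * x ≤ 3/2 := by
    intro x hx
    rcases hs with h | h <;> subst h <;> constructor <;> linarith [hx.1, hx.2]
  have hl : ∀ x : ℝ, HasDerivAt (fun x : ℝ => 1 + s * x) s x := fun x =>
    (((hasDerivAt_id x).const_mul s).const_add 1).congr_deriv (by simp)
  have hp : ∀ (γ : ℝ), ∀ x ∈ Set.Icc (0:ℝ) (1/2),
      HasDerivAt (fun x : ℝ => (1 + s * x) ^ γ) (s * γ * (1 + s * x) ^ (γ - 1)) x := by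
    intro γ x hx
    have : (1 + s * x) ≠ 0 := by linarith [(hy x hx).1]
    exact (hl x).rpow_const (Or.inl this)
  have hBc := hB.continuous
  have hB'c : Continuous (deriv B) := hB.continuous_deriv (le_refl _)
  obtain ⟨M1, hM1⟩ := (isCompact_Icc (a := (1/2:ℝ)) (b := 3/2)).exists_bound_of_continuousOn
    hBc.continuousOn
  obtain ⟨M2, hM2⟩ := (isCompact_Icc (a := (1/2:ℝ)) (b := 3/2)).exists_bound_of_continuousOn
    hB'c.continuousOn
  have hab : 0 < a * β * (1 - β) := mul_pos (mul_pos ha h0) (by linarith)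
  refine half (fun x => a * ((1 + s * x) ^ β - β * (1 + s * x)) - a * (1 - β))
    (fun x => a * β * s * ((1 + s * x) ^ (β - 1) - 1))
    (fun x => -(a * β * (1 - β)) * (1 + s * x) ^ (β - 2))
    (fun x => -(a * β * (1 - β)) * (s * (β - 2) * (1 + s * x) ^ (β - 3)))
    (fun x => B (1 + s * x)) (fun x => deriv B (1 + s * x) * s)
    (a * β * (1 - β) * (3/2) ^ (β - 2)) (a * β * (1 - β) * (2 * (1/2) ^ (β - 3)))
    (max M1 M2) _ (by positivity) (by positivity) ?_ (by positivity) ?_ (by fun_prop)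
    ?_ ?_ ?_ ?_ ?_ ?_ ?_ ?_ (by simp) (by simp) (by simp; ring) (by simpa using hB1)
  · exact le_max_of_le_left ((norm_nonneg _).trans (hM1 1 (by norm_num)))
  · have : Continuous fun x : ℝ => (1 + s * x) ^ β :=
      (Real.continuous_rpow_const h0.le).comp (by fun_prop : Continuous fun x : ℝ => 1 + s * x)
    fun_prop
  · intro x hx
    exact ((((hp β x hx).sub ((hl x).const_mul β)).const_mul a).sub_const _).congr_deriv (by ring)
  · intro x hx
    refine (((hp (β - 1) x hx).sub_const 1).const_mul (a * β * s)).congr_deriv ?_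
    rw [show β - 1 - 1 = β - 2 by ring]
    linear_combination (a * β * (β - 1) * (1 + s * x) ^ (β - 2)) * hs2
  · intro x hx
    refine ((hp (β - 2) x hx).const_mul _).congr_deriv ?_
    rw [show β - 2 - 1 = β - 3 by ring]
  · intro x hx
    exact HasDerivAt.comp x ((hB.differentiable (by simp)) _).hasDerivAt (hl x)
  · intro x hx
    have := Real.rpow_le_rpow_of_nonpos (z := β - 2) (by linarith [(hy x hx).1] : 0 < 1 + s * x)
      (hy x hx).2 (by linarith)
    nlinarith
  · intro x hx
    have h2 := Real.rpow_le_rpow_of_nonpos (z := β - 3) (by norm_num : (0:ℝ) < 1/2)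
      (hy x hx).1 (by linarith)
    have hs' : |s| = 1 := by rcases hs with h | h <;> simp [h]
    have h3 : |β - 2| ≤ 2 := by rw [abs_le]; constructor <;> linarith
    have h4 : 0 < (1 + s * x) ^ (β - 3) := Real.rpow_pos_of_pos (by linarith [(hy x hx).1]) _
    rw [abs_mul, abs_neg, abs_of_pos hab, abs_mul, abs_mul, hs', one_mul, abs_of_pos h4]
    gcongr
  · intro x hx
    exact (hM1 _ (hy x hx)).trans (le_max_left _ _)
  · intro x hx
    have hs' : |s| = 1 := by rcases hs with h | h <;> simp [h]
    rw [abs_mul, hs', mul_one]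
    exact (hM2 _ (hy x hx)).trans (le_max_right _ _)

lemma final (C c : ℝ) (hC : 0 ≤ C) (hc : 0 < c) (F : ℝ → ℂ)
    (h : ∀ t d : ℝ, 0 < t → 0 < d → d ≤ 1/2 →
      ‖F t - (Real.pi / (1 + Complex.I * (c : ℝ) * t)) ^ (1 / 2 : ℂ)‖ ≤
        C * (t * d ^ 4 + d ^ 2 + 1 / (t * d))) :
    ∃ c₁ c₂ T : ℝ, 0 < c₁ ∧ 0 < c₂ ∧ 0 < T ∧ ∀ t : ℝ, T ≤ t →
      ‖F t‖ ∈ Set.Icc (c₁ * t ^ (-(1 / 2) : ℝ)) (c₂ * t ^ (-(1 / 2) : ℝ)) := by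
  set k1 := (Real.pi / (2 * c)) ^ (1/2 : ℝ) with hk1
  set k2 := (Real.pi / c) ^ (1/2 : ℝ) with hk2
  have hk1p : 0 < k1 := by have := Real.pi_pos; positivity
  have hk2p : 0 < k2 := by have := Real.pi_pos; positivity
  have lim1 : Filter.Tendsto (fun t : ℝ => 3 * C * t ^ (-(1/10) : ℝ)) Filter.atTop (nhds 0) := by
    simpa using (tendsto_rpow_neg_atTop (by norm_num : (0:ℝ) < 1/10)).const_mul (3 * C)
  have lim2 : Filter.Tendsto (fun t : ℝ => t ^ (-(2/5) : ℝ)) Filter.atTop (nhds 0) :=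
    tendsto_rpow_neg_atTop (by norm_num)
  have ev := (lim1.eventually_le_const (half_pos hk1p)).and
    (lim2.eventually_le_const (by norm_num : (0:ℝ) < 1/2))
  obtain ⟨T, hT⟩ := Filter.eventually_atTop.1 ev
  refine ⟨k1 / 2, k2 + k1 / 2, max T (max 1 (1 / c)), by positivity, by positivity,
    by positivity, fun t ht => ?_⟩
  obtain ⟨ht1, ht2⟩ := hT t ((le_max_left _ _).trans ht)
  have ht3 : 1 ≤ t := ((le_max_left _ _).trans (le_max_right _ _)).trans ht
  have ht4 : 1 / c ≤ t := ((le_max_right _ _).trans (le_max_right _ _)).trans ht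
  have htp : 0 < t := by linarith
  have h1ct : 1 ≤ c * t := by rw [div_le_iff₀ hc] at ht4; linarith
  have hd : 0 < t ^ (-(2/5) : ℝ) := Real.rpow_pos_of_pos htp _
  have key := h t _ htp hd ht2
  set W : ℂ := (Real.pi / (1 + Complex.I * (c : ℝ) * t)) ^ (1 / 2 : ℂ) with hW
  have p1 : t * (t ^ (-(2/5) : ℝ)) ^ 4 = t ^ (-(3/5) : ℝ) := by
    rw [← Real.rpow_natCast, ← Real.rpow_mul htp.le]
    nth_rewrite 1 [← Real.rpow_one t]
    rw [← Real.rpow_add htp]; norm_num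
  have p2 : (t ^ (-(2/5) : ℝ)) ^ 2 ≤ t ^ (-(3/5) : ℝ) := by
    rw [← Real.rpow_natCast, ← Real.rpow_mul htp.le]
    apply Real.rpow_le_rpow_of_exponent_le ht3; norm_num
  have p3 : 1 / (t * t ^ (-(2/5) : ℝ)) = t ^ (-(3/5) : ℝ) := by
    nth_rewrite 1 [← Real.rpow_one t]
    rw [← Real.rpow_add htp, one_div, ← Real.rpow_neg htp.le]; norm_num
  have p4 : t ^ (-(3/5) : ℝ) = t ^ (-(1/10) : ℝ) * t ^ (-(1/2) : ℝ) := by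
    rw [← Real.rpow_add htp]; norm_num
  have hq : 0 < t ^ (-(1/2) : ℝ) := Real.rpow_pos_of_pos htp _
  have err : ‖F t - W‖ ≤ k1 / 2 * t ^ (-(1/2) : ℝ) := by
    refine key.trans ?_
    calc _ ≤ C * (t ^ (-(3/5) : ℝ) + t ^ (-(3/5) : ℝ) + t ^ (-(3/5) : ℝ)) := by
          rw [p1, p3]; gcongr
      _ = 3 * C * t ^ (-(1/10) : ℝ) * t ^ (-(1/2) : ℝ) := by rw [p4]; ring
      _ ≤ _ := by gcongr
  have hWn : ‖W‖ = (Real.pi / ‖1 + Complex.I * (c : ℝ) * t‖) ^ (1/2 : ℝ) := by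
    rw [hW, show (1/2 : ℂ) = ((1/2 : ℝ) : ℂ) by push_cast; rfl, Complex.norm_cpow_real, norm_div,
      Complex.norm_real, Real.norm_eq_abs, abs_of_pos Real.pi_pos]
  have bu : ‖1 + Complex.I * (c : ℝ) * t‖ ≤ 2 * c * t := by
    refine (norm_add_le _ _).trans ?_
    rw [norm_mul, norm_mul, Complex.norm_I, Complex.norm_real, Complex.norm_real, norm_one,
      Real.norm_eq_abs, Real.norm_eq_abs, abs_of_pos hc, abs_of_pos htp]
    linarith
  have bl : c * t ≤ ‖1 + Complex.I * (c : ℝ) * t‖ := by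
    have := Complex.abs_im_le_norm (1 + Complex.I * (c : ℝ) * t)
    simp at this
    rwa [abs_of_pos hc, abs_of_pos htp] at this
  have hpi := Real.pi_pos
  have hct : 0 < c * t := by positivity
  have sp : ∀ u : ℝ, 0 < u → (Real.pi / (u * t)) ^ (1/2 : ℝ) =
      (Real.pi / u) ^ (1/2 : ℝ) * t ^ (-(1/2) : ℝ) := by
    intro u hu
    rw [← div_div, div_eq_mul_inv _ t, Real.mul_rpow (by positivity) (by positivity),
      Real.inv_rpow htp.le, Real.rpow_neg htp.le]
  have wl : k1 * t ^ (-(1/2) : ℝ) ≤ ‖W‖ := by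
    rw [hWn, hk1, ← sp _ (by positivity)]
    apply Real.rpow_le_rpow (by positivity) _ (by norm_num)
    exact div_le_div_of_nonneg_left hpi.le (by linarith) bu
  have wu : ‖W‖ ≤ k2 * t ^ (-(1/2) : ℝ) := by
    rw [hWn, hk2, ← sp _ hc]
    apply Real.rpow_le_rpow (by positivity) _ (by norm_num)
    exact div_le_div_of_nonneg_left hpi.le (by linarith) bl
  have n1 : ‖W‖ ≤ ‖F t‖ + ‖F t - W‖ := by
    have := norm_sub_le (F t) (F t - W)
    simpa using this
  have n2 : ‖F t‖ ≤ ‖W‖ + ‖F t - W‖ := by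
    have := norm_add_le W (F t - W)
    simpa using this
  constructor
  · linarith
  · linarith

/-- Sharpness of the `|t|^{-1/2}` decay for the half-wave propagator `e^{it𝓛^{α/2}}`
on the Heisenberg group: with `s₀ = (α/2)·(4n)^{α/2}`, the oscillatory integral
`∫ e^{it(−λs₀ + (4nλ)^{α/2})} Q(λ) λ^n dλ` is comparable to `t^{-1/2}` as `t → ∞`. -/
theorem statement17 (n : ℕ) (hn : 1 ≤ n) (α : ℝ) (hα0 : 0 < α) (hα2 : α < 2) :
    ∃ ε : ℝ, ε ∈ Set.Ioo (0 : ℝ) 1 ∧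
      ∀ Q : ℝ → ℝ, ContDiff ℝ (⊤ : ℕ∞) Q → HasCompactSupport Q →
        tsupport Q ⊆ Set.Ioo (1 - ε) (1 + ε) → Q 1 = 1 →
        ∃ c₁ c₂ T : ℝ, 0 < c₁ ∧ 0 < c₂ ∧ 0 < T ∧ ∀ t : ℝ, T ≤ t →
          ‖∫ lam : ℝ,
              Complex.exp (Complex.I * t *
                ((-(lam * (α / 2 * (4 * (n : ℝ)) ^ (α / 2))) +
                  (4 * (n : ℝ) * lam) ^ (α / 2) : ℝ) : ℂ)) *
                ((Q lam * lam ^ n : ℝ) : ℂ)‖ ∈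
            Set.Icc (c₁ * t ^ (-(1 / 2) : ℝ)) (c₂ * t ^ (-(1 / 2) : ℝ)) := by
  have h4n : (0:ℝ) < 4 * n := by
    have : (1:ℝ) ≤ n := by exact_mod_cast hn
    linarith
  set β := α / 2 with hβ
  have hβ0 : 0 < β := by positivity
  have hβ1 : β < 1 := by rw [hβ]; linarith
  set a := (4 * (n:ℝ)) ^ β with ha_def
  have ha : 0 < a := Real.rpow_pos_of_pos h4n _
  refine ⟨1/2, by norm_num, fun Q hQ hQc hsupp hQ1 => ?_⟩
  set B : ℝ → ℝ := fun x => Q x * x ^ n with hBdef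
  have hB : ContDiff ℝ 1 B := (hQ.of_le (by exact_mod_cast le_top)).mul (by fun_prop)
  have hB1 : B 1 = 1 := by simp [hBdef, hQ1]
  obtain ⟨C1, hC1, b1⟩ := side a β 1 ha hβ0 hβ1 (Or.inl rfl) B hB hB1
  obtain ⟨C2, hC2, b2⟩ := side a β (-1) ha hβ0 hβ1 (Or.inr rfl) B hB hB1
  set H : ℝ → ℝ → ℂ := fun s t => ∫ x in (0:ℝ)..(1/2), Complex.exp (Complex.I * t *
          ((a * ((1 + s * x) ^ β - β * (1 + s * x)) - a * (1 - β) : ℝ) : ℂ)) *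
          (B (1 + s * x) : ℝ) with hH
  have hab : 0 < a * β * (1 - β) := mul_pos (mul_pos ha hβ0) (by linarith)
  obtain ⟨c₁, c₂, T, hc₁, hc₂, hT, hfin⟩ := final (C1 + C2) (a * β * (1 - β) / 2) (by positivity)
    (by positivity) (fun t => H 1 t + H (-1) t) (by
      intro t d ht hd hd2
      have e1 := b1 t d ht hd hd2
      have e2 := b2 t d ht hd hd2
      refine le_trans (le_of_eq ?_) ((norm_add_le _ _).trans ((add_le_add e1 e2).trans
        (le_of_eq (by ring))))
      congr 1
      simp only [hH]
      ring)
  refine ⟨c₁, c₂, T, hc₁, hc₂, hT, fun t ht => ?_⟩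
  convert hfin t ht using 1
  set f : ℝ → ℂ := fun lam => Complex.exp (Complex.I * t *
                ((-(lam * (β * a)) + (4 * (n : ℝ) * lam) ^ β : ℝ) : ℂ)) *
                ((Q lam * lam ^ n : ℝ) : ℂ) with hf
  have hfc : Continuous f := by
    have h1 : Continuous fun x : ℝ => (4 * (n : ℝ) * x) ^ β :=
      (Real.continuous_rpow_const hβ0.le).comp (by fun_prop : Continuous fun x : ℝ => 4 * (n:ℝ) * x)
    have h2 := hQ.continuous
    fun_prop
  have hsf : Function.support f ⊆ Set.Ioc (1/2) (3/2) := by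
    intro x hx
    have hQx : Q x ≠ 0 := by
      intro h0
      apply hx
      simp [hf, h0]
    have := hsupp (subset_tsupport Q hQx)
    constructor <;> linarith [this.1, this.2]
  have hfv : ∀ s : ℝ, (s = 1 ∨ s = -1) → ∫ x in (0:ℝ)..(1/2), f (1 + s * x) =
      Complex.exp (Complex.I * t * ((a * (1 - β) : ℝ) : ℂ)) * H s t := by
    intro s hs
    simp only [hH]
    rw [← intervalIntegral.integral_const_mul]
    apply intervalIntegral.integral_congr
    intro x hx
    rw [Set.uIcc_of_le (by norm_num)] at hx
    have hy : 0 ≤ 1 + s * x := by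
      rcases hs with h | h <;> subst h <;> linarith [hx.1, hx.2]
    simp only [hf, hBdef]
    rw [Real.mul_rpow h4n.le hy, ← ha_def, ← mul_assoc (Complex.exp _), ← Complex.exp_add]
    congr 2
    push_cast
    ring
  have tot : ∫ lam, f lam = Complex.exp (Complex.I * t * ((a * (1 - β) : ℝ) : ℂ)) *
      (H 1 t + H (-1) t) := by
    rw [← intervalIntegral.integral_eq_integral_of_support_subset hsf,
      ← intervalIntegral.integral_add_adjacent_intervals (hfc.intervalIntegrable _ 1)
      (hfc.intervalIntegrable _ _), mul_add, ← hfv 1 (Or.inl rfl), ← hfv (-1) (Or.inr rfl), add_comm]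
    congr 1
    · simp only [one_mul]
      rw [intervalIntegral.integral_comp_add_left f 1]; norm_num
    · simp only [neg_one_mul, ← sub_eq_add_neg]
      rw [intervalIntegral.integral_comp_sub_left f 1]; norm_num
  rw [tot, norm_mul, Complex.norm_exp]
  simp
end

section
/- Let n ≥ 1, N = 2n+2, and let φ(r) = r² + r. Then there is a constant C > 0, depending only on n and R*, such that for every j ∈ ℤ, every t ≠ 0 and every (z,s) ∈ ℂ^n × ℝ, the fourth-order Schrödinger kernel satisfies |F_j^φ(t,z,s)| ≤ C |t|^{−1/2} 2^{j(N−2)}. -/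
open MeasureTheory

lemma le_of_hasDeriv_nonpos {f f' : ℝ → ℝ} {a b : ℝ} (hab : a ≤ b)
    (hd : ∀ x ∈ Set.Icc a b, HasDerivAt f (f' x) x)
    (hn : ∀ x ∈ Set.Icc a b, f' x ≤ 0) : f b ≤ f a := by
  have h : AntitoneOn f (Set.Icc a b) := by
    apply antitoneOn_of_deriv_nonpos (convex_Icc a b)
    · intro x hx; exact (hd x hx).continuousAt.continuousWithinAt
    · intro x hx; exact (hd x (interior_subset hx)).differentiableAt.differentiableWithinAt
    · intro x hx
      rw [(hd x (interior_subset hx)).deriv]; exact hn x (interior_subset hx)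
  exact h (Set.left_mem_Icc.2 hab) (Set.right_mem_Icc.2 hab) hab

lemma energy_bound {u q r : ℝ → ℝ} {K : ℝ} (hK : 1/2 ≤ K)
    (hu : ∀ y, HasDerivAt u (q y) y) (hq : ∀ y, HasDerivAt q (r y) y)
    (hode : ∀ y, y * r y + q y = (y/4 - K) * u y) (hu0 : u 0 = 1)
    (hlim : Filter.Tendsto (fun y => u y * (y * q y)) Filter.atTop (nhds 0)) :
    ∀ y, 0 ≤ y → u y ^ 2 ≤ 144 * K ∧ (y * q y) ^ 2 ≤ 36 * K := by
  have hid : ∀ y : ℝ, HasDerivAt (fun y : ℝ => y) 1 y := fun y => hasDerivAt_id y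
  have hv : ∀ y, HasDerivAt (fun y => y * q y) ((y/4 - K) * u y) y := by
    intro y
    refine ((hid y).fun_mul (hq y)).congr_deriv ?_
    rw [← hode]; ring
  -- first energy
  have hE : ∀ y, 0 ≤ y → y * q y ^ 2 + (K - y/4) * u y ^ 2 ≤ K := by
    intro y hy
    have := le_of_hasDeriv_nonpos (f := fun y => y * q y ^ 2 + (K - y/4) * u y ^ 2)
      (f' := fun y => - q y ^ 2 - u y ^ 2 / 4) hy (fun x _ => by
        have h1 := ((hid x).fun_mul ((hq x).fun_pow 2)).fun_add
          ((((hid x).div_const 4).const_sub K).fun_mul ((hu x).fun_pow 2))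
        refine h1.congr_deriv ?_
        have := hode x
        push_cast
        linear_combination 2 * q x * this)
      (fun x _ => by nlinarith [sq_nonneg (q x), sq_nonneg (u x)])
    simpa [hu0] using this
  have hK0 : 0 < K := by linarith
  have hy0 : 0 < 1 / (2 * K) := by positivity
  -- small y
  have hsmall : ∀ y, 0 ≤ y → y ≤ 1 / (2 * K) → u y ^ 2 ≤ 2 ∧ (y * q y) ^ 2 ≤ 1/2 := by
    intro y hy hy1
    have h1 : y * K ≤ 1/2 := by
      rw [le_div_iff₀ (by positivity)] at hy1; linarith
    have h2 : y / 4 ≤ K / 2 := by nlinarith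
    have h3 := hE y hy
    have hu2 := sq_nonneg (u y)
    have hq2 := mul_nonneg hy (sq_nonneg (q y))
    constructor
    · have : K / 2 * u y ^ 2 ≤ K := by nlinarith
      nlinarith
    · have : y * q y ^ 2 ≤ K := by nlinarith
      calc (y * q y)^2 = y * (y * q y ^ 2) := by ring
        _ ≤ y * K := by gcongr
        _ ≤ 1/2 := h1
  -- middle
  set P : ℝ → ℝ := fun y => (y * q y + u y / 4)^2 + u y ^ 2 / 16 + y * (K - y/4) * u y ^ 2 with hP
  have hPd : ∀ y, HasDerivAt P (2 * (y * q y + u y / 4) * ((y/4 - K) * u y + q y / 4) + u y * q y / 8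
      + ((K - y/2) * u y ^ 2 + y * (K - y/4) * (2 * u y * q y))) y := by
    intro y
    have h1 := ((((hv y).fun_add ((hu y).div_const 4)).fun_pow 2).fun_add
      (((hu y).fun_pow 2).div_const 16)).fun_add
      (((hid y).fun_mul (((hid y).div_const 4).const_sub K)).fun_mul ((hu y).fun_pow 2))
    refine h1.congr_deriv ?_
    push_cast; ring
  have hmid : ∀ y, 1 / (2 * K) ≤ y → y ≤ 4 * K → P y ≤ 9 * K := by
    intro y hy1 hy2
    have hypos : 0 < y := lt_of_lt_of_le hy0 hy1
    have hJ := le_of_hasDeriv_nonpos (f := fun y => P y / √y) (f' := fun y =>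
       (- u y ^ 2 / (16 * y) - y / 4 * u y ^ 2) / √ y) hy1 (fun x hx => by
        have hx0 : 0 < x := lt_of_lt_of_le hy0 hx.1
        have hs : 0 < √x := Real.sqrt_pos.2 hx0
        have h1 := (hPd x).fun_div (Real.hasDerivAt_sqrt hx0.ne') hs.ne'
        refine h1.congr_deriv ?_
        simp only [hP]
        have hxx : x = √x ^ 2 := (Real.sq_sqrt hx0.le).symm
        generalize √x = w at *
        subst hxx
        field_simp
        ring)
      (fun x hx => by
        have hx0 : 0 < x := lt_of_lt_of_le hy0 hx.1
        have hs : 0 < √x := Real.sqrt_pos.2 hx0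
        apply div_nonpos_of_nonpos_of_nonneg _ hs.le
        have : 0 ≤ u x ^ 2 / (16 * x) := by positivity
        have : 0 ≤ x / 4 * u x ^ 2 := by positivity
        rw [neg_div]; linarith)
    have hP0 : P (1 / (2 * K)) ≤ 3 := by
      obtain ⟨h1, h2⟩ := hsmall _ hy0.le le_rfl
      simp only [hP]
      set w := 1 / (2 * K)
      have hw : w * K = 1/2 := by simp only [w]; field_simp
      have h3 : w * (K - w/4) * u w ^ 2 ≤ 1/2 * u w ^ 2 := by
        gcongr; nlinarith [sq_nonneg w]
      nlinarith [sq_nonneg (w * q w - u w / 4)]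
    have hs : 0 < √y := Real.sqrt_pos.2 hypos
    have hs0 : 0 < √(1 / (2 * K)) := Real.sqrt_pos.2 hy0
    have h4 : P y ≤ 3 * (√y / √(1 / (2 * K))) := by
      rw [div_le_div_iff₀ hs hs0] at hJ
      rw [← mul_div_assoc, le_div_iff₀ hs0]
      nlinarith
    have h5 : √y / √(1 / (2 * K)) ≤ 3 * K := by
      rw [← Real.sqrt_div hypos.le]
      apply Real.sqrt_le_iff.2 ⟨by linarith, ?_⟩
      rw [div_div_eq_mul_div, div_one]
      nlinarith
    linarith
  have hlow : ∀ y, 0 ≤ y → y ≤ 4 * K → u y ^ 2 ≤ 144 * K ∧ (y * q y) ^ 2 ≤ 36 * K := by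
    intro y hy hy2
    rcases le_total y (1 / (2 * K)) with h | h
    · obtain ⟨h1, h2⟩ := hsmall y hy h
      constructor <;> linarith
    · have h1 := hmid y h hy2
      simp only [hP] at h1
      have h2 : 0 ≤ y * (K - y/4) * u y ^ 2 := by
        apply mul_nonneg (mul_nonneg hy (by linarith)) (sq_nonneg _)
      constructor
      · nlinarith [sq_nonneg (y * q y + u y / 4)]
      · nlinarith [sq_nonneg (y * q y + u y / 2)]
  have hneg : ∀ y, 4 * K ≤ y → u y * (y * q y) ≤ 0 := by
    intro y hy
    refine ge_of_tendsto hlim (Filter.eventually_atTop.2 ⟨y, fun b hb => ?_⟩)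
    have := le_of_hasDeriv_nonpos (f := fun y => -(u y * (y * q y)))
      (f' := fun y => -(y * q y ^ 2 + (y/4 - K) * u y ^ 2)) hb (fun x _ => by
        refine (((hu x).fun_mul (hv x)).fun_neg).congr_deriv ?_
        ring) (fun x hx => by
          have : 0 ≤ x * q x ^ 2 := mul_nonneg (by linarith [hx.1]) (sq_nonneg _)
          have : 0 ≤ (x/4 - K) * u x ^ 2 := mul_nonneg (by linarith [hx.1]) (sq_nonneg _)
          linarith)
    linarith
  intro y hy
  rcases le_total y (4 * K) with h | h
  · exact hlow y hy h
  obtain ⟨h1, h2⟩ := hlow (4 * K) (by linarith) le_rfl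
  have huq : ∀ x ∈ Set.Icc (4 * K) y, u x * q x ≤ 0 := by
    intro x hx
    have := hneg x hx.1
    have hx0 : 0 < x := by linarith [hx.1]
    by_contra hc
    push Not at hc
    nlinarith
  constructor
  · refine le_trans ?_ h1
    exact le_of_hasDeriv_nonpos (f := fun y => u y ^ 2) (f' := fun y => 2 * (u y * q y)) h
      (fun x _ => ((hu x).fun_pow 2).congr_deriv (by push_cast; ring))
      (fun x hx => by linarith [huq x hx])
  · refine le_trans ?_ h2
    exact le_of_hasDeriv_nonpos (f := fun y => (y * q y) ^ 2)
      (f' := fun y => 2 * ((y/4 - K) * (y * (u y * q y)))) h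
      (fun x _ => ((hv x).fun_pow 2).congr_deriv (by push_cast; ring))
      (fun x hx => by
        have h1 : 0 ≤ x/4 - K := by linarith [hx.1]
        have h2 : x * (u x * q x) ≤ 0 :=
          mul_nonpos_of_nonneg_of_nonpos (by linarith [hx.1]) (huq x hx)
        nlinarith [mul_nonpos_of_nonneg_of_nonpos h1 h2])

lemma laguerreL_succ (d m : ℕ) (t : ℝ) :
    laguerreL (d+1) (m+1) t = laguerreL (d+1) m t + laguerreL d (m+1) t := by
  unfold laguerreL
  rw [Finset.sum_range_succ _ (m+1), Finset.sum_range_succ _ (m+1), ← add_assoc (G := ℝ),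
    ← Finset.sum_add_distrib]
  congr 1
  · apply Finset.sum_congr rfl
    intro k hk
    have hk : k ≤ m := by simpa [Nat.lt_succ_iff] using hk
    have : (m + 1 + (d + 1)).choose (m + 1 - k)
        = (m + (d+1)).choose (m - k) + (m + 1 + d).choose (m + 1 - k) := by
      rw [Nat.sub_add_comm hk, show m + 1 + (d+1) = (m + (d+1)) + 1 by ring, Nat.choose_succ_succ,
        show m + 1 + d = m + (d+1) by ring]
    rw [this]; push_cast; ring
  · simp

lemma laguerreL_zero (d : ℕ) (t : ℝ) : laguerreL d 0 t = 1 := by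
  simp [laguerreL]

lemma laguerreL_sum (d m : ℕ) (t : ℝ) :
    laguerreL (d+1) m t = ∑ k ∈ Finset.range (m+1), laguerreL d k t := by
  induction m with
  | zero => simp [laguerreL_zero]
  | succ m ih => rw [laguerreL_succ, ih, Finset.sum_range_succ _ (m+1)]

open Polynomial in
noncomputable def lagPoly (m : ℕ) : ℝ[X] :=
  ∑ k ∈ Finset.range (m + 1), monomial k ((-1 : ℝ) ^ k * (Nat.choose m k) / (Nat.factorial k))

lemma lagPoly_eval (m : ℕ) (t : ℝ) : (lagPoly m).eval t = laguerreL 0 m t := by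
  unfold lagPoly laguerreL
  rw [Polynomial.eval_finsetSum]
  apply Finset.sum_congr rfl
  intro k hk
  have hk : k ≤ m := by simpa [Nat.lt_succ_iff] using hk
  rw [Polynomial.eval_monomial, add_zero, Nat.choose_symm hk]
  ring

lemma lagPoly_coeff (m k : ℕ) :
    (lagPoly m).coeff k = (-1 : ℝ) ^ k * (Nat.choose m k) / (Nat.factorial k) := by
  unfold lagPoly
  rw [Polynomial.finsetSum_coeff]
  simp only [Polynomial.coeff_monomial]
  rw [Finset.sum_ite_eq']
  split_ifs with h
  · rfl
  · rw [Nat.choose_eq_zero_of_lt (by simpa using h)]; simp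

lemma lagPoly_coeff_succ (m k : ℕ) :
    ((k:ℝ) + 1)^2 * (lagPoly m).coeff (k+1) = -((m:ℝ) - k) * (lagPoly m).coeff k := by
  rw [lagPoly_coeff, lagPoly_coeff, Nat.factorial_succ]
  have h : ((m.choose (k+1) : ℕ) : ℝ) * (k + 1) = (m.choose k : ℕ) * ((m:ℝ) - k) := by
    rcases le_or_gt k m with hk | hk
    · have := Nat.choose_succ_right_eq m k
      rw [← Nat.cast_sub hk]; exact_mod_cast this
    · rw [Nat.choose_eq_zero_of_lt hk, Nat.choose_eq_zero_of_lt (by omega)]; simp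
  have hf : (k.factorial : ℝ) ≠ 0 := by positivity
  push_cast
  rw [pow_succ]
  field_simp
  linear_combination (-(-1:ℝ)^k) * h

open Polynomial in
lemma lagPoly_ode (m : ℕ) :
    X * derivative (derivative (lagPoly m)) + derivative (lagPoly m) - X * derivative (lagPoly m)
      + C (m:ℝ) * lagPoly m = 0 := by
  ext k
  rcases k with _ | k
  · have := lagPoly_coeff_succ m 0
    simp [coeff_derivative] at this ⊢
    linarith
  · have := lagPoly_coeff_succ m (k+1)
    simp only [coeff_add, coeff_sub, coeff_X_mul, coeff_derivative, coeff_C_mul, coeff_zero]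
    push_cast at this ⊢
    linear_combination this

noncomputable def lagf (d m : ℕ) (y : ℝ) : ℝ := laguerreL d m y * Real.exp (-(y/2))

lemma exp_half_deriv (y : ℝ) :
    HasDerivAt (fun y : ℝ => Real.exp (-(y/2))) (-(1/2) * Real.exp (-(y/2))) y := by
  refine ((((hasDerivAt_id y).div_const 2).fun_neg).exp).congr_deriv ?_
  simp; ring

open Polynomial in
lemma polyexp_deriv (p : ℝ[X]) (y : ℝ) :
    HasDerivAt (fun y : ℝ => p.eval y * Real.exp (-(y/2)))
      ((derivative p - C (1/2) * p).eval y * Real.exp (-(y/2))) y := by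
  refine ((p.hasDerivAt y).fun_mul (exp_half_deriv y)).congr_deriv ?_
  simp; ring

open Polynomial in
lemma lagf_bound_zero (m : ℕ) : ∃ g : ℝ → ℝ, Continuous g ∧ (∀ y, HasDerivAt (lagf 0 m) (g y) y) ∧
    ∀ y, 0 ≤ y → |lagf 0 m y| ≤ 12 * √((m:ℝ)+1) ∧ |y * g y| ≤ 12 * √((m:ℝ)+1) := by
  have hl : lagf 0 m = fun y : ℝ => (lagPoly m).eval y * Real.exp (-(y/2)) := by
    funext y; rw [lagPoly_eval]; rfl
  set p := lagPoly m with hp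
  set p1 := derivative p - C (1/2) * p with hp1
  set p2 := derivative p1 - C (1/2) * p1 with hp2
  have hb := energy_bound (u := lagf 0 m) (q := fun y => p1.eval y * Real.exp (-(y/2)))
    (r := fun y => p2.eval y * Real.exp (-(y/2))) (K := m + 1/2) (by
      have : (0:ℝ) ≤ m := by positivity
      linarith) (by rw [hl]; exact polyexp_deriv p) (polyexp_deriv p1) (by
      intro y
      have h := congrArg (fun P => P.eval y) (lagPoly_ode m)
      rw [← hp] at h
      rw [hl]
      simp only [hp2, hp1]
      simp at h ⊢
      linear_combination Real.exp (-(y/2)) * h) (by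
      rw [hl]
      have := lagPoly_coeff m 0
      simp only [← coeff_zero_eq_eval_zero]
      rw [this]; simp) (by
      have := (p * (X * p1)).tendsto_div_exp_atTop
      refine this.congr ?_
      intro y
      rw [hl]
      have : Real.exp y = (Real.exp (-(y/2)))⁻¹ * (Real.exp (-(y/2)))⁻¹ := by
        rw [← Real.exp_neg, ← Real.exp_add]; congr 1; ring
      rw [this, ← mul_inv, div_inv_eq_mul]; simp only [eval_mul, eval_X]; ring)
  refine ⟨fun y => p1.eval y * Real.exp (-(y/2)), by fun_prop, by rw [hl]; exact polyexp_deriv p, ?_⟩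
  intro y hy
  obtain ⟨h1, h2⟩ := hb y hy
  have hs : (12 * √((m:ℝ)+1))^2 = 144 * (m + 1) := by
    rw [mul_pow, Real.sq_sqrt (by positivity)]; norm_num
  have hm : (0:ℝ) ≤ m := by positivity
  constructor <;> apply abs_le_of_sq_le_sq _ (by positivity) <;> linarith

lemma lagf_bound (d : ℕ) : ∀ m : ℕ, ∃ g : ℝ → ℝ, Continuous g ∧
    (∀ y, HasDerivAt (lagf d m) (g y) y) ∧
    ∀ y, 0 ≤ y → |lagf d m y| ≤ 12 * √((m:ℝ)+1) * ((m:ℝ)+1)^d ∧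
      |y * g y| ≤ 12 * √((m:ℝ)+1) * ((m:ℝ)+1)^d := by
  induction d with
  | zero => simpa using lagf_bound_zero
  | succ d ih =>
    choose g hc hd hb using ih
    intro m
    have hl : lagf (d+1) m = fun y => ∑ k ∈ Finset.range (m+1), lagf d k y := by
      funext y; simp only [lagf, laguerreL_sum, Finset.sum_mul]
    have key : ∀ f : ℕ → ℝ, (∀ k, |f k| ≤ 12 * √((k:ℝ)+1) * ((k:ℝ)+1)^d) →
        |∑ k ∈ Finset.range (m+1), f k| ≤ 12 * √((m:ℝ)+1) * ((m:ℝ)+1)^(d+1) := by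
      intro f hf
      calc |∑ k ∈ Finset.range (m+1), f k| ≤ ∑ k ∈ Finset.range (m+1), |f k| :=
            Finset.abs_sum_le_sum_abs _ _
        _ ≤ ∑ k ∈ Finset.range (m+1), 12 * √((m:ℝ)+1) * ((m:ℝ)+1)^d := by
            apply Finset.sum_le_sum
            intro k hk
            have hk : (k:ℝ) ≤ m := by
              exact_mod_cast (by simpa [Nat.lt_succ_iff] using hk : k ≤ m)
            refine (hf k).trans ?_
            gcongr
        _ = _ := by simp; ring
    refine ⟨fun y => ∑ k ∈ Finset.range (m+1), g k y, ?_, ?_, ?_⟩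
    · exact continuous_finsetSum _ (fun k _ => hc k)
    · intro y
      rw [hl]
      exact HasDerivAt.fun_sum (fun k _ => hd k y)
    · intro y hy
      constructor
      · rw [hl]; exact key _ (fun k => (hb k y hy).1)
      · simp only [Finset.mul_sum]
        exact key _ (fun k => (hb k y hy).2)

lemma fresnel (e : ℝ) (he : |e| = 1) : ∃ F : ℝ → ℂ,
    (∀ x, HasDerivAt F (Complex.exp (Complex.I * (e * x ^ 2 : ℝ))) x) ∧ ∀ x, ‖F x‖ ≤ 2 := by
  set f : ℝ → ℂ := fun x => Complex.exp (Complex.I * (e * x ^ 2 : ℝ)) with hf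
  have hfc : Continuous f := by fun_prop
  have hfn : ∀ x, ‖f x‖ = 1 := fun x => by
    simp only [hf]; rw [mul_comm, Complex.norm_exp_ofReal_mul_I]
  set F : ℝ → ℂ := fun x => ∫ y in (0:ℝ)..x, f y with hF
  have hFd : ∀ x, HasDerivAt F (f x) x := fun x => hfc.integral_hasStrictDerivAt 0 x |>.hasDerivAt
  have he0 : e ≠ 0 := by rintro rfl; simp at he
  have hec : (e : ℂ) ≠ 0 := by exact_mod_cast he0
  refine ⟨F, hFd, ?_⟩
  have hodd : ∀ x, F (-x) = - F x := by
    intro x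
    have h1 : ∀ y, f (-y) = f y := fun y => by simp [hf]
    have h2 := intervalIntegral.integral_comp_neg (a := 0) (b := x) f
    simp only [h1, neg_zero] at h2
    simp only [hF]
    rw [h2, intervalIntegral.integral_symm]
  have h01 : ∀ x, 0 ≤ x → x ≤ 1 → ‖F x‖ ≤ 1 := by
    intro x h0 h1
    have := intervalIntegral.norm_integral_le_of_norm_le_const (a := 0) (b := x) (f := f) (C := 1)
      (fun y _ => (hfn y).le)
    rw [sub_zero, abs_of_nonneg h0] at this
    simp only [hF]; linarith
  have h1 : ∀ x, 1 ≤ x → ‖F x‖ ≤ 2 := by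
    intro x hx
    set W : ℝ → ℂ := fun y => f y * (((2 * e * y)⁻¹ : ℝ) * (-Complex.I)) with hW
    have hWn : ∀ y, 0 < y → ‖W y‖ = 1 / (2 * y) := by
      intro y hy
      simp only [hW]
      rw [norm_mul, hfn, norm_mul, norm_neg, Complex.norm_I, Complex.norm_real, Real.norm_eq_abs,
        abs_inv, abs_mul, abs_mul, he, abs_of_pos hy]
      norm_num
    have hWd : ∀ y, 0 < y → HasDerivAt W (f y + f y * ((-(2 * e)/(2 * e * y)^2 : ℝ) * (-Complex.I))) y := by
      intro y hy
      have a1 : HasDerivAt (fun y : ℝ => e * y ^ 2) (e * (2 * y)) y := by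
        refine ((hasDerivAt_id y).fun_pow 2 |>.const_mul e).congr_deriv ?_
        simp
      have a2 : HasDerivAt f (f y * (Complex.I * (e * (2 * y) : ℝ))) y :=
        (a1.ofReal_comp.const_mul Complex.I).cexp
      have a3 : HasDerivAt (fun y : ℝ => (2 * e * y)⁻¹) (-(2 * e)/(2 * e * y)^2) y := by
        have := ((hasDerivAt_id y).const_mul (2 * e)).fun_inv (by simp [he0, hy.ne'])
        simpa using this
      refine (a2.fun_mul (a3.ofReal_comp.mul_const (-Complex.I))).congr_deriv ?_
      have hyc : (y : ℂ) ≠ 0 := by exact_mod_cast hy.ne'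
      congr 1
      have : Complex.I * ((e * (2 * y) : ℝ):ℂ) * (((2 * e * y)⁻¹ : ℝ) * -Complex.I) = 1 := by
        push_cast
        field_simp
        simp
      rw [mul_assoc, this, mul_one]
    have := image_norm_le_of_norm_deriv_right_le_deriv_boundary' (a := 1) (b := x)
      (f := fun y => (F y - W y) - (F 1 - W 1))
      (f' := fun y => f y - (f y + f y * ((-(2 * e)/(2 * e * y)^2 : ℝ) * (-Complex.I))))
      (B := fun y => 1/2 - (2 * y)⁻¹) (B' := fun y => 2 / (2 * y)^2)
      (fun y hy => by
        have hy0 : 0 < y := by linarith [hy.1]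
        exact (((hFd y).sub (hWd y hy0)).sub_const _).continuousAt.continuousWithinAt)
      (fun y hy => by
        have hy0 : 0 < y := by linarith [hy.1]
        exact (((hFd y).sub (hWd y hy0)).sub_const _).hasDerivWithinAt)
      (by simp)
      (fun y hy => by
        have hy0 : 0 < y := by linarith [hy.1]
        exact ContinuousAt.continuousWithinAt (by
          apply ContinuousAt.sub continuousAt_const
          apply ContinuousAt.inv₀ (by fun_prop) (by positivity)))
      (fun y hy => by
        have hy0 : 0 < y := by linarith [hy.1]
        have := (((hasDerivAt_id y).const_mul 2).fun_inv (by simp [hy0.ne'])).const_sub (1/2)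
        refine HasDerivAt.hasDerivWithinAt (this.congr_deriv ?_)
        simp; ring)
      (fun y hy => by
        have hy0 : 0 < y := by linarith [hy.1]
        rw [sub_add_cancel_left, norm_neg, norm_mul, hfn, norm_mul, norm_neg, Complex.norm_I,
          Complex.norm_real, Real.norm_eq_abs, abs_div, abs_neg, abs_pow, abs_mul, abs_mul, abs_mul, he,
          abs_of_pos hy0]
        norm_num)
      (Set.right_mem_Icc.2 hx)
    have hx0 : 0 < x := by linarith
    have e1 := hWn x hx0
    have e2 := hWn 1 one_pos
    have e3 := h01 1 zero_le_one le_rfl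
    have e4 : F x = ((F x - W x) - (F 1 - W 1)) + W x + F 1 - W 1 := by ring
    have e5 : (2 * x)⁻¹ = 1 / (2 * x) := by simp
    rw [e4]
    have e6 := norm_sub_le (((F x - W x) - (F 1 - W 1)) + W x + F 1) (W 1)
    have e7 := norm_add_le (((F x - W x) - (F 1 - W 1)) + W x) (F 1)
    have e8 := norm_add_le ((F x - W x) - (F 1 - W 1)) (W x)
    simp only [e5] at this
    linarith
  have hpos : ∀ x, 0 ≤ x → ‖F x‖ ≤ 2 := by
    intro x hx
    rcases le_total x 1 with h | h
    · linarith [h01 x hx h]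
    · exact h1 x h
  intro x
  rcases le_total 0 x with h | h
  · exact hpos x h
  · have := hpos (-x) (by linarith)
    rwa [hodd, norm_neg] at this

lemma fresnel_quad (A B : ℝ) (hA : A ≠ 0) : ∃ H : ℝ → ℂ,
    (∀ x, HasDerivAt H (Complex.exp (Complex.I * (A * x ^ 2 + B * x : ℝ))) x) ∧
    ∀ x, ‖H x‖ ≤ 2 / √|A| := by
  have hA0 : 0 < |A| := abs_pos.2 hA
  obtain ⟨F, hF, hFb⟩ := fresnel (A / |A|) (by rw [abs_div, abs_abs, div_self hA0.ne'])
  have hw : 0 < √|A| := Real.sqrt_pos.2 hA0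
  refine ⟨fun x => Complex.exp (Complex.I * (-(B^2/(4*A)) : ℝ)) *
    (F (√|A| * (x + B/(2*A))) / (√|A| : ℝ)), ?_, ?_⟩
  · intro x
    have h1 : HasDerivAt (fun x : ℝ => √|A| * (x + B/(2*A))) (√|A|) x := by
      simpa using ((hasDerivAt_id x).add_const (B/(2*A))).const_mul (√|A|)
    have h2 := (((hF _).scomp x h1).div_const ((√|A| : ℝ) : ℂ)).const_mul
      (Complex.exp (Complex.I * (-(B^2/(4*A)) : ℝ)))
    refine h2.congr_deriv ?_
    rw [Complex.real_smul, mul_div_cancel_left₀ _ (by exact_mod_cast hw.ne'), ← Complex.exp_add,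
      ← mul_add, ← Complex.ofReal_add]
    congr 3
    rw [mul_pow, Real.sq_sqrt hA0.le]
    field_simp
    ring
  · intro x
    rw [norm_mul, mul_comm Complex.I, Complex.norm_exp_ofReal_mul_I, one_mul, norm_div,
      Complex.norm_real, Real.norm_of_nonneg hw.le]
    gcongr
    exact hFb _

lemma osc_bound {A B a b D : ℝ} (hA : A ≠ 0) (hab : a ≤ b) {ψ ψ' : ℝ → ℝ}
    (hd : ∀ x, HasDerivAt ψ (ψ' x) x) (hc : Continuous ψ') (ha : ψ a = 0) (hb : ψ b = 0)
    (hD : ∀ x, a ≤ x → x ≤ b → |ψ' x| ≤ D) :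
    ‖∫ x in a..b, Complex.exp (Complex.I * (A * x ^ 2 + B * x : ℝ)) * (ψ x : ℂ)‖
      ≤ 2 / √|A| * D * (b - a) := by
  obtain ⟨H, hH, hHb⟩ := fresnel_quad A B hA
  have h := intervalIntegral.integral_mul_deriv_eq_deriv_mul (a := a) (b := b)
    (u := fun x => (ψ x : ℂ)) (u' := fun x => (ψ' x : ℂ)) (v := H)
    (fun x _ => (hd x).ofReal_comp) (fun x _ => hH x)
    ((by fun_prop : Continuous fun x => (ψ' x : ℂ)).intervalIntegrable _ _)
    ((by fun_prop : Continuous fun x : ℝ => 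
      Complex.exp (Complex.I * (A * x ^ 2 + B * x : ℝ))).intervalIntegrable _ _)
  simp only [ha, hb, Complex.ofReal_zero, zero_mul, sub_zero, zero_sub] at h
  simp only [mul_comm _ (Complex.ofReal (ψ _))]
  rw [h, norm_neg]
  have := intervalIntegral.norm_integral_le_of_norm_le_const (a := a) (b := b)
    (f := fun x => (ψ' x : ℂ) * H x) (C := 2 / √|A| * D) (by
      intro x hx
      rw [Set.uIoc_of_le hab] at hx
      have h1 := hD x hx.1.le hx.2
      rw [norm_mul, Complex.norm_real, Real.norm_eq_abs, mul_comm]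
      exact mul_le_mul (hHb x) h1 (abs_nonneg _) (by positivity))
  rwa [abs_of_nonneg (sub_nonneg.2 hab)] at this

lemma half_bound {n m : ℕ} (hn : 1 ≤ n) {R : ℝ → ℝ} (hRsm : ContDiff ℝ (⊤ : ℕ∞) R)
    (hRsupp : ∀ τ, R τ ≠ 0 → 1 / 2 ≤ |τ| ∧ |τ| ≤ 4) {CR : ℝ}
    (hC : ∀ x, |R x| ≤ CR) (hC' : ∀ x, |deriv R x| ≤ CR)
    {A B b ρ : ℝ} (hA : A ≠ 0) (hb : 0 < b) (hρ : 0 ≤ ρ) :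
    ‖∫ x in (1/(4*b))..(5/b), Complex.exp (Complex.I * (A * x ^ 2 + B * x : ℝ)) *
      ((R (b * x) * lagf (n-1) m (2 * ρ * x) * x ^ n : ℝ) : ℂ)‖
      ≤ 2 / √|A| * (20 * (5/b)^n * CR * (12 * √((m:ℝ)+1) * ((m:ℝ)+1)^(n-1)) * (6+n)) := by
  obtain ⟨g, hgc, hgd, hgb⟩ := lagf_bound (n-1) m
  set L := 12 * √((m:ℝ)+1) * ((m:ℝ)+1)^(n-1) with hL
  have hL0 : 0 ≤ L := by positivity
  have hCR0 : 0 ≤ CR := (abs_nonneg _).trans (hC 0)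
  have hRd : Differentiable ℝ R := hRsm.differentiable (by simp)
  have hRdc : Continuous (deriv R) := hRsm.continuous_deriv (by simp)
  have hlc : Continuous (lagf (n-1) m) := by
    rw [continuous_iff_continuousAt]; exact fun y => (hgd y).continuousAt
  have hRz : ∀ τ, ¬ (1/2 ≤ |τ| ∧ |τ| ≤ 4) → R τ = 0 := fun τ h => by
    by_contra hc; exact h (hRsupp τ hc)
  have hlin : ∀ c x : ℝ, HasDerivAt (fun x => c * x) c x := fun c x => by
    simpa using (hasDerivAt_id x).const_mul c
  have key := osc_bound (A := A) (B := B) (a := 1/(4*b)) (b := 5/b)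
    (D := 4 * b * ((5/b)^n * CR * L * (6 + n))) hA
    (by rw [div_le_div_iff₀ (by positivity) hb]; linarith)
    (ψ := fun x => R (b * x) * lagf (n-1) m (2 * ρ * x) * x ^ n)
    (ψ' := fun x => (deriv R (b * x) * b * lagf (n-1) m (2 * ρ * x)
      + R (b * x) * (g (2 * ρ * x) * (2 * ρ))) * x ^ n
      + R (b * x) * lagf (n-1) m (2 * ρ * x) * (n * x ^ (n-1)))
    (fun x => by
      have h1 := ((hRd (b * x)).hasDerivAt).comp x (hlin b x)
      have h2 := (hgd (2 * ρ * x)).comp x (hlin (2 * ρ) x)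
      exact (h1.fun_mul h2).fun_mul (hasDerivAt_pow n x))
    (by have := hRd.continuous; fun_prop)
    (by
      have : b * (1/(4*b)) = 1/4 := by field_simp
      simp only [this]
      rw [hRz (1/4) (by norm_num [abs_of_pos])]; simp)
    (by
      have : b * (5/b) = 5 := by field_simp
      simp only [this]
      rw [hRz 5 (by norm_num [abs_of_pos])]; simp)
    (by
      intro x hx1 hx2
      have hx0 : 0 < x := lt_of_lt_of_le (by positivity) hx1
      have hbx : b * x ≤ 5 := by rw [le_div_iff₀ hb] at hx2; linarith
      have hbx' : 1 ≤ 4 * b * x := by rw [div_le_iff₀ (by positivity)] at hx1; linarith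
      obtain ⟨k1, k2⟩ := hgb (2 * ρ * x) (by positivity)
      set ℓ := lagf (n-1) m (2 * ρ * x)
      set G := g (2 * ρ * x)
      have hxn : x ^ n ≤ (5/b)^n := by gcongr
      have e : x * ((deriv R (b * x) * b * ℓ + R (b * x) * (G * (2 * ρ))) * x ^ n
          + R (b * x) * ℓ * (n * x ^ (n-1)))
          = (deriv R (b * x) * (b * x) * ℓ + R (b * x) * (2 * ρ * x * G) + R (b * x) * ℓ * n) * x ^ n := by
        obtain ⟨k, rfl⟩ : ∃ k, n = k + 1 := ⟨n - 1, by omega⟩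
        simp only [Nat.add_sub_cancel]
        ring
      have hcl : ∀ p q : ℝ, |p| ≤ CR → |q| ≤ L → |p * q| ≤ CR * L := fun p q hp hq => by
        rw [abs_mul]; exact mul_le_mul hp hq (abs_nonneg _) hCR0
      have f1 : |deriv R (b * x) * (b * x) * ℓ| ≤ 5 * (CR * L) := by
        rw [show deriv R (b * x) * (b * x) * ℓ = (b * x) * (deriv R (b * x) * ℓ) by ring, abs_mul,
          abs_of_pos (by positivity : 0 < b * x)]
        exact mul_le_mul hbx (hcl _ _ (hC' _) k1) (abs_nonneg _) (by norm_num)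
      have f2 : |R (b * x) * (2 * ρ * x * G)| ≤ CR * L := hcl _ _ (hC _) k2
      have f3 : |R (b * x) * ℓ * n| ≤ CR * L * n := by
        rw [abs_mul, Nat.abs_cast]
        gcongr
        exact hcl _ _ (hC _) k1
      have f4 : |deriv R (b * x) * (b * x) * ℓ + R (b * x) * (2 * ρ * x * G) + R (b * x) * ℓ * n|
          ≤ CR * L * (6 + n) := by
        refine (abs_add_le _ _).trans ?_
        have := abs_add_le (deriv R (b * x) * (b * x) * ℓ) (R (b * x) * (2 * ρ * x * G))
        linarith
      set Q := (deriv R (b * x) * b * ℓ + R (b * x) * (G * (2 * ρ))) * x ^ n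
          + R (b * x) * ℓ * (n * x ^ (n-1)) with hQ
      have f5 : x * |Q| ≤ CR * L * (6 + n) * (5/b)^n := by
        rw [show x * |Q| = |x * Q| by rw [abs_mul, abs_of_pos hx0], e, abs_mul, abs_of_pos (by positivity : 0 < x ^ n)]
        exact mul_le_mul f4 hxn (by positivity) (by positivity)
      calc |Q| = 1 * |Q| := by ring
        _ ≤ (4 * b * x) * |Q| := by gcongr
        _ = 4 * b * (x * |Q|) := by ring
        _ ≤ 4 * b * (CR * L * (6 + n) * (5/b)^n) := by gcongr
        _ = _ := by ring)
  refine key.trans ?_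
  have h5 : b * (5/b - 1/(4*b)) ≤ 5 := by
    rw [mul_sub]
    have h1 : b * (5/b) = 5 := by field_simp
    have h2 : b * (1/(4*b)) = 1/4 := by field_simp
    linarith
  calc 2 / √|A| * (4 * b * ((5/b)^n * CR * L * (6 + n))) * (5/b - 1/(4*b))
      = 2 / √|A| * (4 * ((5/b)^n * CR * L * (6 + n))) * (b * (5/b - 1/(4*b))) := by ring
    _ ≤ 2 / √|A| * (4 * ((5/b)^n * CR * L * (6 + n))) * 5 := by gcongr
    _ = _ := by ring

lemma integral_two_sides {f : ℝ → ℂ} (hf : Continuous f) {α β : ℝ} (hα : 0 < α) (hαβ : α ≤ β)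
    (hs : ∀ x, f x ≠ 0 → α < |x| ∧ |x| ≤ β) :
    ∫ x, f x = (∫ x in α..β, f x) + ∫ x in α..β, f (-x) := by
  have hcs : HasCompactSupport f := by
    apply HasCompactSupport.of_support_subset_isCompact (isCompact_Icc (a := -β) (b := β))
    intro x hx
    exact abs_le.1 (hs x hx).2
  have hi := hf.integrable_of_hasCompactSupport (μ := volume) hcs
  have key : ∀ g : ℝ → ℂ, (∀ x, g x ≠ 0 → α < |x| ∧ |x| ≤ β) →
      ∫ x in Set.Ioi 0, g x = ∫ x in α..β, g x := by
    intro g hg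
    rw [intervalIntegral.integral_of_le hαβ]
    apply setIntegral_eq_of_subset_of_forall_sdiff_eq_zero measurableSet_Ioi
    · intro x hx; exact hα.trans hx.1
    · rintro x ⟨hx, hx'⟩
      by_contra hc
      have := hg x hc
      rw [abs_of_pos hx] at this
      exact hx' this
  rw [← intervalIntegral.integral_Iic_add_Ioi (b := 0) hi.integrableOn hi.integrableOn, add_comm, key f hs]
  congr 1
  rw [← key (fun x => f (-x)) (fun x hx => by simpa using hs (-x) hx), integral_comp_neg_Ioi, neg_zero]

lemma Fterm_bound_s18 {n : ℕ} (hn : 1 ≤ n) {R : ℝ → ℝ} (hRsm : ContDiff ℝ (⊤ : ℕ∞) R)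
    (hRsupp : ∀ τ, R τ ≠ 0 → 1 / 2 ≤ |τ| ∧ |τ| ≤ 4) {CR : ℝ}
    (hC : ∀ x, |R x| ≤ CR) (hC' : ∀ x, |deriv R x| ≤ CR) (j : ℤ) {t : ℝ} (ht : t ≠ 0)
    (z : Fin n → ℂ) (s : ℝ) (m : ℕ) :
    ‖Fterm n R (fun r => r ^ 2 + r) j t z s m‖ ≤
      (240 * 5^n * CR * (6+n)) * (|t| ^ (-(1 / 2) : ℝ) *
        (2 : ℝ) ^ ((j : ℝ) * ((2 * (n : ℝ) + 2) - 2))) * ((m:ℝ)+1)^(-(3/2) : ℝ) := by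
  have hCR0 : 0 ≤ CR := (abs_nonneg _).trans (hC 0)
  have hn' : (1:ℝ) ≤ n := by exact_mod_cast hn
  set M : ℝ := 2 * (m:ℝ) + n with hM
  have hm0 : (0:ℝ) ≤ m := by positivity
  have hMm : (m:ℝ) + 1 ≤ M := by linarith
  have hM0 : 0 < M := by linarith
  set c : ℝ := (2:ℝ) ^ (-(2:ℤ) * j) with hc
  have hc0 : 0 < c := by positivity
  set b := c * M with hb
  have hb0 : 0 < b := by positivity
  set ρ := hnormSq z with hρ
  have hρ0 : 0 ≤ ρ := Finset.sum_nonneg (fun i _ => Complex.normSq_nonneg _)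
  set A := 16 * t * M ^ 2 with hAdef
  have hA : A ≠ 0 := by positivity
  have hlag : Continuous (laguerreL (n-1) m) := by unfold laguerreL; fun_prop
  have hRc : Continuous R := hRsm.continuous
  have hα : 0 < 1/(4*b) := by positivity
  have hαβ : 1/(4*b) ≤ 5/b := by rw [div_le_div_iff₀ (by positivity) hb0]; linarith
  have hhalf := fun B => half_bound (m := m) hn hRsm hRsupp hC hC' (B := B) hA hb0 hρ0
  set T := 2 / √|A| * (20 * (5/b)^n * CR * (12 * √((m:ℝ)+1) * ((m:ℝ)+1)^(n-1)) * (6+n)) with hT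
  have h1 : ‖Fterm n R (fun r => r ^ 2 + r) j t z s m‖ ≤ T + T := by
    unfold Fterm
    rw [integral_two_sides (α := 1/(4*b)) (β := 5/b) (by fun_prop) hα hαβ]
    · refine (norm_add_le _ _).trans (add_le_add ?_ ?_)
      · refine le_trans (le_of_eq ?_) (hhalf (4 * t * M - s))
        congr 1
        apply intervalIntegral.integral_congr
        intro x hx
        rw [Set.uIcc_of_le hαβ] at hx
        have hx0 : 0 < x := hα.trans_le hx.1
        simp only [abs_of_pos hx0]
        rw [← Complex.exp_add]
        congr 1
        · congr 1; simp only [hAdef, hM]; push_cast; ring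
        · simp only [lagf]; congr 1
          rw [show -(2 * ρ * x / 2) = -(x * ρ) by ring, show 2 * x * ρ = 2 * ρ * x by ring]
          ring
      · refine le_trans (le_of_eq ?_) (hhalf (4 * t * M + s))
        congr 1
        apply intervalIntegral.integral_congr
        intro x hx
        rw [Set.uIcc_of_le hαβ] at hx
        have hx0 : 0 < x := hα.trans_le hx.1
        simp only [abs_neg, abs_of_pos hx0]
        rw [← Complex.exp_add]
        congr 1
        · congr 1; simp only [hAdef, hM]; push_cast; ring
        · simp only [lagf]; congr 1
          rw [show -(2 * ρ * x / 2) = -(x * ρ) by ring, show 2 * x * ρ = 2 * ρ * x by ring]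
          ring
    · intro x hx
      have hR : R (b * |x|) ≠ 0 := by
        intro h0
        apply hx
        simp only [← hM, ← hc, ← hb, h0]
        simp
      have := hRsupp _ hR
      rw [abs_mul, abs_abs, abs_of_pos hb0] at this
      constructor
      · rw [div_lt_iff₀ (by positivity)]; linarith [this.1]
      · rw [le_div_iff₀ hb0]; linarith [this.2]
  refine h1.trans ?_
  have ht0 : 0 < |t| := abs_pos.2 ht
  have hsA : √|A| = 4 * M * √|t| := by
    have : |A| = (4 * M)^2 * |t| := by
      simp only [hAdef]; rw [abs_mul, abs_mul, abs_of_pos (by norm_num : (0:ℝ) < 16), abs_of_pos (by positivity : 0 < M^2)]; ring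
    rw [this, Real.sqrt_mul (by positivity), Real.sqrt_sq (by positivity)]
  have htr : |t| ^ (-(1 / 2) : ℝ) = 1 / √|t| := by
    rw [Real.rpow_neg ht0.le, Real.sqrt_eq_rpow]; simp
  have hcr : (2 : ℝ) ^ ((j : ℝ) * ((2 * (n : ℝ) + 2) - 2)) = (1/c)^n := by
    rw [hc, show (j : ℝ) * ((2 * (n : ℝ) + 2) - 2) = ((2 * j * n : ℤ) : ℝ) by push_cast; ring,
      Real.rpow_intCast, one_div, ← zpow_neg, ← zpow_natCast, ← zpow_mul]
    congr 1; ring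
  have hmr : ((m:ℝ)+1)^(-(3/2) : ℝ) = √((m:ℝ)+1) / ((m:ℝ)+1)^2 := by
    rw [Real.sqrt_eq_rpow, ← Real.rpow_natCast, ← Real.rpow_sub (by positivity)]
    norm_num
  rw [htr, hcr, hmr, hT, hsA]
  have hpow : ((m:ℝ)+1)^(n-1) / M^(n+1) ≤ 1 / ((m:ℝ)+1)^2 := by
    rw [div_le_div_iff₀ (by positivity) (by positivity), one_mul, ← pow_add]
    rw [show n - 1 + 2 = n + 1 by omega]
    gcongr
  have hst : 0 < √|t| := Real.sqrt_pos.2 ht0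
  have e1 : 2 / (4 * M * √|t|) * (20 * (5/b)^n * CR * (12 * √((m:ℝ)+1) * ((m:ℝ)+1)^(n-1)) * (6+n))
     + 2 / (4 * M * √|t|) * (20 * (5/b)^n * CR * (12 * √((m:ℝ)+1) * ((m:ℝ)+1)^(n-1)) * (6+n))
     = (240 * 5^n * CR * (6+n)) * (1 / √|t| * (1/c)^n) * √((m:ℝ)+1) * (((m:ℝ)+1)^(n-1) / M^(n+1)) := by
    have h5 : (5/b)^n = 5^n * (1/c)^n / M^n := by
      rw [hb, div_pow, mul_pow, div_pow, one_pow]; field_simp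
    rw [h5, pow_succ M n]
    generalize (1/c)^n = w
    field_simp
    ring
  rw [e1]
  calc _ ≤ (240 * 5^n * CR * (6+n)) * (1 / √|t| * (1/c)^n) * √((m:ℝ)+1) * (1 / ((m:ℝ)+1)^2) := by
        gcongr
    _ = _ := by ring

/-- Decay estimate for the frequency-localized fourth-order Schrödinger propagator
(`φ(r) = r² + r`): `|F_j^φ(t,z,s)| ≤ C |t|^{-1/2} 2^{j(N-2)}` for all `j ∈ ℤ`,
`t ≠ 0`, where `N = 2n+2`. -/
theorem statement18 (n : ℕ) (hn : 1 ≤ n)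
    (R : ℝ → ℝ) (hRsm : ContDiff ℝ (⊤ : ℕ∞) R) (hRcs : HasCompactSupport R)
    (hRev : ∀ τ, R (-τ) = R τ) (hRpos : ∀ τ, 0 ≤ R τ)
    (hRsupp : ∀ τ, R τ ≠ 0 → 1 / 2 ≤ |τ| ∧ |τ| ≤ 4)
    (hRsum : ∀ τ : ℝ, τ ≠ 0 → HasSum (fun j : ℤ => R ((2 : ℝ) ^ (-(2 : ℤ) * j) * τ)) 1) :
    ∃ C : ℝ, 0 < C ∧ ∀ j : ℤ, ∀ t : ℝ, t ≠ 0 → ∀ (z : Fin n → ℂ) (s : ℝ),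
      ‖Fkernel n R (fun r => r ^ 2 + r) j t z s‖ ≤
        C * |t| ^ (-(1 / 2) : ℝ) * (2 : ℝ) ^ ((j : ℝ) * ((2 * (n : ℝ) + 2) - 2)) := by
  obtain ⟨C1, hC1⟩ := hRcs.exists_bound_of_continuous hRsm.continuous
  obtain ⟨C2, hC2⟩ := hRcs.deriv.exists_bound_of_continuous (hRsm.continuous_deriv (by simp))
  set CR := max 1 (max C1 C2) with hCR
  have hCR1 : 1 ≤ CR := le_max_left _ _
  have hb1 : ∀ x, |R x| ≤ CR := fun x => (hC1 x).trans ((le_max_left _ _).trans (le_max_right _ _))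
  have hb2 : ∀ x, |deriv R x| ≤ CR :=
    fun x => (hC2 x).trans ((le_max_right _ _).trans (le_max_right _ _))
  have hsum : Summable (fun m : ℕ => ((m:ℝ)+1)^(-(3/2) : ℝ)) := by
    have h := (Real.summable_nat_rpow (p := -(3/2))).2 (by norm_num)
    have h' := (summable_nat_add_iff 1).2 h
    simpa using h'
  set S := ∑' m : ℕ, ((m:ℝ)+1)^(-(3/2) : ℝ) with hS
  have hS0 : 0 < S := hsum.tsum_pos (fun m => by positivity) 0 (by positivity)
  refine ⟨2 ^ (n - 1) / Real.pi ^ (n + 1) * ((240 * 5^n * CR * (6+n)) * S), by positivity, ?_⟩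
  intro j t ht z s
  unfold Fkernel
  rw [norm_mul, Complex.norm_real, Real.norm_of_nonneg (by positivity)]
  have h := tsum_of_norm_bounded (hsum.hasSum.mul_left ((240 * 5^n * CR * (6+n)) *
    (|t| ^ (-(1 / 2) : ℝ) * (2 : ℝ) ^ ((j : ℝ) * ((2 * (n : ℝ) + 2) - 2)))))
    (fun m => Fterm_bound_s18 hn hRsm hRsupp hb1 hb2 j ht z s m)
  calc _ ≤ 2 ^ (n - 1) / Real.pi ^ (n + 1) * (((240 * 5^n * CR * (6+n)) *
    (|t| ^ (-(1 / 2) : ℝ) * (2 : ℝ) ^ ((j : ℝ) * ((2 * (n : ℝ) + 2) - 2)))) * S) := by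
        gcongr
    _ = _ := by ring
end

section
/- Let n ≥ 1 and set s₀ = 32n² + 4n. Then there exists ε ∈ (0,1) such that for every smooth compactly supported Q : ℝ → ℝ with support contained in (1−ε, 1+ε) and Q(1) = 1, there exist constants c₁, c₂, T > 0 such that for all t ≥ T, c₁ t^{−1/2} ≤ | ∫_ℝ e^{i t (−λ s₀ + (4nλ)² + 4nλ)} Q(λ) λ^n dλ | ≤ c₂ t^{−1/2}. (This shows the decay rate |t|^{−1/2} for the fourth-order Schrödinger semigroup e^{it(𝓛²+𝓛)} on the Heisenberg group is sharp.) -/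
open MeasureTheory

open Complex in
open scoped FourierTransform SchwartzMap in
lemma aux_parseval (h : 𝓢(ℝ, ℂ)) {b : ℂ} (hb : 0 < b.re) :
    ∫ x : ℝ, cexp (-b * (x : ℂ) ^ 2) * h x =
      (Real.pi / b) ^ (1 / 2 : ℂ) *
        ∫ w : ℝ, cexp (-(Real.pi : ℂ) ^ 2 * (w : ℂ) ^ 2 / b) * (𝓕⁻ h) w := by
  have h1 : (𝓕 (𝓕⁻ h : 𝓢(ℝ, ℂ)) : 𝓢(ℝ, ℂ)) = h := FourierTransform.fourier_fourierInv_eq h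
  have key := VectorFourier.integral_fourierIntegral_smul_eq_flip (L := innerₗ ℝ)
    (e := Real.fourierChar) (μ := volume) (ν := volume)
    (f := fun x : ℝ => cexp (-b * (x : ℂ) ^ 2)) (g := fun x : ℝ => (𝓕⁻ h : 𝓢(ℝ, ℂ)) x)
    Real.continuous_fourierChar continuous_inner (integrable_cexp_neg_mul_sq hb)
    (𝓕⁻ h : 𝓢(ℝ, ℂ)).integrable
  have e1 : ∀ w : ℝ, VectorFourier.fourierIntegral Real.fourierChar volume (innerₗ ℝ)
      (fun x : ℝ => cexp (-b * (x : ℂ) ^ 2)) w =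
      (Real.pi / b) ^ (1 / 2 : ℂ) * cexp (-(Real.pi : ℂ) ^ 2 * (w : ℂ) ^ 2 / b) := by
    intro w
    have := fourier_gaussian_innerProductSpace (V := ℝ) hb w
    simp only [Real.norm_eq_abs, Module.finrank_self, Nat.cast_one] at this
    norm_cast at this ⊢
    simp only [sq_abs] at this
    exact this
  have e2 : ∀ w : ℝ, VectorFourier.fourierIntegral Real.fourierChar volume (innerₗ ℝ).flip
      (fun x : ℝ => (𝓕⁻ h : 𝓢(ℝ, ℂ)) x) w = h w := by
    intro w
    rw [flip_innerₗ]
    exact congrArg (fun f : 𝓢(ℝ, ℂ) => f w) h1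
  simp only [e1, e2, smul_eq_mul] at key
  rw [← key, ← integral_const_mul]
  simp only [mul_assoc]

open Complex Filter Topology in
open scoped FourierTransform SchwartzMap in
lemma aux_tendsto (h : 𝓢(ℝ, ℂ)) {A : ℝ} (hA : 0 < A) :
    Tendsto (fun t : ℝ => ∫ w : ℝ, cexp (-(Real.pi : ℂ) ^ 2 * (w : ℂ) ^ 2 / (1 - I * t * A)) *
      (𝓕⁻ h) w) atTop (𝓝 (h 0)) := by
  have h1 : (𝓕 (𝓕⁻ h : 𝓢(ℝ, ℂ)) : 𝓢(ℝ, ℂ)) = h := FourierTransform.fourier_fourierInv_eq h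
  have h0 : h 0 = ∫ w : ℝ, (𝓕⁻ h) w := by
    conv_lhs => rw [← h1]
    rw [SchwartzMap.fourier_coe, Real.fourier_eq]
    simp
  rw [h0]
  have hinv : Tendsto (fun t : ℝ => (1 - I * t * A)⁻¹) atTop (𝓝 0) := by
    refine tendsto_inv₀_cobounded.comp ?_
    rw [← tendsto_norm_atTop_iff_cobounded]
    refine tendsto_atTop_mono (fun t => ?_) (tendsto_id.atTop_mul_const hA)
    have := (neg_le_abs _).trans (abs_im_le_norm (1 - I * t * A))
    simpa using this
  apply tendsto_integral_filter_of_dominated_convergence _ _ _ (𝓕⁻ h : 𝓢(ℝ, ℂ)).integrable.norm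
  · refine Eventually.of_forall fun w => ?_
    have : Tendsto (fun t : ℝ => cexp (-(Real.pi : ℂ) ^ 2 * (w : ℂ) ^ 2 * (1 - I * t * A)⁻¹) *
      (𝓕⁻ h) w) atTop (𝓝 (cexp (-(Real.pi : ℂ) ^ 2 * (w : ℂ) ^ 2 * 0) * (𝓕⁻ h) w)) :=
      ((continuous_exp.tendsto _).comp (hinv.const_mul _)).mul_const _
    simpa [div_eq_mul_inv] using this
  · refine Eventually.of_forall fun t => Continuous.aestronglyMeasurable ?_
    have := (𝓕⁻ h : 𝓢(ℝ, ℂ)).continuous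
    fun_prop
  · refine Eventually.of_forall fun t => Eventually.of_forall fun w => ?_
    rw [norm_mul, norm_exp]
    refine mul_le_of_le_one_left (norm_nonneg _) ?_
    rw [Real.exp_le_one_iff]
    have : -(Real.pi : ℂ) ^ 2 * (w : ℂ) ^ 2 / (1 - I * t * A) =
      ((-(Real.pi ^ 2 * w ^ 2) : ℝ) : ℂ) * (1 - I * t * A)⁻¹ := by
      push_cast; ring
    rw [this, re_ofReal_mul, inv_re]
    have h3 : (1 - I * t * A).re = 1 := by simp
    rw [h3]
    have : 0 ≤ 1 / normSq (1 - I * t * A) := by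
      have := normSq_nonneg (1 - I * t * A)
      positivity
    have := mul_nonneg (show 0 ≤ Real.pi ^ 2 * w ^ 2 by positivity) this
    linarith

open Complex in
lemma aux_norm {A t : ℝ} (hA : 1 ≤ A) (ht : 1 ≤ t) :
    ‖((Real.pi : ℂ) / (1 - I * t * A)) ^ (1 / 2 : ℂ)‖ ∈
      Set.Icc ((Real.pi / (2 * A)) ^ (1 / 2 : ℝ) * t ^ (-(1 / 2) : ℝ))
        ((Real.pi / A) ^ (1 / 2 : ℝ) * t ^ (-(1 / 2) : ℝ)) := by
  have ht0 : 0 < t := by linarith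
  have hA0 : 0 < A := by linarith
  have hpi := Real.pi_pos
  have e : (1 / 2 : ℂ) = ((1 / 2 : ℝ) : ℂ) := by push_cast; rfl
  rw [e, norm_cpow_real, norm_div, norm_real, Real.norm_of_nonneg hpi.le]
  have lo : t * A ≤ ‖1 - I * t * A‖ := by
    have := (neg_le_abs _).trans (abs_im_le_norm (1 - I * t * A))
    simpa using this
  have hi : ‖1 - I * t * A‖ ≤ 2 * A * t := by
    have := norm_sub_le (1 : ℂ) (I * t * A)
    simp only [norm_one, norm_mul, norm_I, norm_real, Real.norm_of_nonneg hA0.le,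
      Real.norm_of_nonneg ht0.le] at this
    nlinarith
  have hp : 0 < t * A := by positivity
  have hn : 0 < ‖1 - I * t * A‖ := by linarith
  rw [Real.rpow_neg ht0.le, ← Real.inv_rpow ht0.le, ← Real.mul_rpow (by positivity) (by positivity),
    ← Real.mul_rpow (by positivity) (by positivity)]
  constructor
  · refine Real.rpow_le_rpow (by positivity) ?_ (by norm_num)
    rw [← div_eq_mul_inv, div_div]
    gcongr
  · refine Real.rpow_le_rpow (by positivity) ?_ (by norm_num)
    rw [← div_eq_mul_inv, div_div, mul_comm A]
    gcongr

/-- Sharpness of the `|t|^{-1/2}` decay for the fourth-order Schrödinger semigroup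
`e^{it(𝓛²+𝓛)}` on the Heisenberg group: with `s₀ = 32n² + 4n`, the oscillatory integral
`∫ e^{it(−λs₀ + (4nλ)² + 4nλ)} Q(λ) λ^n dλ` is comparable to `t^{-1/2}` as `t → ∞`. -/
theorem statement19 (n : ℕ) (hn : 1 ≤ n) :
    ∃ ε : ℝ, ε ∈ Set.Ioo (0 : ℝ) 1 ∧
      ∀ Q : ℝ → ℝ, ContDiff ℝ (⊤ : ℕ∞) Q → HasCompactSupport Q →
        tsupport Q ⊆ Set.Ioo (1 - ε) (1 + ε) → Q 1 = 1 →
        ∃ c₁ c₂ T : ℝ, 0 < c₁ ∧ 0 < c₂ ∧ 0 < T ∧ ∀ t : ℝ, T ≤ t →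
          ‖∫ lam : ℝ,
              Complex.exp (Complex.I * t *
                ((-(lam * (32 * (n : ℝ) ^ 2 + 4 * (n : ℝ))) +
                  (4 * (n : ℝ) * lam) ^ 2 + 4 * (n : ℝ) * lam : ℝ) : ℂ)) *
                ((Q lam * lam ^ n : ℝ) : ℂ)‖ ∈
            Set.Icc (c₁ * t ^ (-(1 / 2) : ℝ)) (c₂ * t ^ (-(1 / 2) : ℝ)) := by
  refine ⟨1 / 2, ⟨by norm_num, by norm_num⟩, ?_⟩
  intro Q hQ hQc _ hQ1
  have hn' : (1 : ℝ) ≤ n := by exact_mod_cast hn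
  obtain ⟨A, hAdef⟩ : ∃ A : ℝ, A = 16 * (n : ℝ) ^ 2 := ⟨_, rfl⟩
  have hA : 1 ≤ A := by rw [hAdef]; nlinarith
  have hpi := Real.pi_pos
  let hf : ℝ → ℂ := fun x => ((Real.exp (x ^ 2) * (Q (x + 1) * (x + 1) ^ n) : ℝ) : ℂ)
  have hc : HasCompactSupport hf := by
    have h1 : HasCompactSupport (fun x : ℝ => Q (x + 1)) :=
      hQc.comp_homeomorph (Homeomorph.addRight (1 : ℝ))
    refine h1.mono ?_
    intro x hx
    simp only [Function.mem_support] at hx ⊢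
    contrapose! hx
    simp [hf, hx]
  have hs : ContDiff ℝ (⊤ : ℕ∞) hf := by
    refine Complex.ofRealCLM.contDiff.comp ?_
    have : ContDiff ℝ (⊤ : ℕ∞) (fun x : ℝ => Q (x + 1)) := hQ.comp (by fun_prop)
    have h2 : ContDiff ℝ (⊤ : ℕ∞)
        (fun x : ℝ => Real.exp (x ^ 2) * (Q (x + 1) * (x + 1) ^ n)) := by fun_prop
    exact h2
  let h := hc.toSchwartzMap hs
  have hh : ∀ x, h x = hf x := fun x => rfl
  have h0 : h 0 = 1 := by rw [hh]; simp [hf, hQ1]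
  have hlim := (aux_tendsto h (A := A) (by linarith)).norm
  rw [h0, norm_one] at hlim
  have hev := (hlim.eventually (Icc_mem_nhds (show (1 / 2 : ℝ) < 1 by norm_num)
    (show (1 : ℝ) < 2 by norm_num)))
  obtain ⟨T, hT⟩ := Filter.eventually_atTop.1 hev
  refine ⟨(Real.pi / (2 * A)) ^ (1 / 2 : ℝ) * (1 / 2), (Real.pi / A) ^ (1 / 2 : ℝ) * 2, max T 1,
    by positivity, by positivity, by positivity, ?_⟩
  intro t ht
  have ht1 : 1 ≤ t := (le_max_right _ _).trans ht
  have ht0 : 0 < t := by linarith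
  have hJ := hT t ((le_max_left _ _).trans ht)
  have hN := aux_norm hA ht1
  have hb : 0 < (1 - Complex.I * t * A).re := by simp
  have hP := aux_parseval h hb
  rw [← integral_add_right_eq_self _ (1 : ℝ)]
  have hI : ∀ x : ℝ, Complex.exp (Complex.I * t *
                ((-((x + 1) * (32 * (n : ℝ) ^ 2 + 4 * (n : ℝ))) +
                  (4 * (n : ℝ) * (x + 1)) ^ 2 + 4 * (n : ℝ) * (x + 1) : ℝ) : ℂ)) *
                ((Q (x + 1) * (x + 1) ^ n : ℝ) : ℂ) =
      Complex.exp (((-(A * t) : ℝ) : ℂ) * Complex.I) *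
        (Complex.exp (-(1 - Complex.I * t * A) * (x : ℂ) ^ 2) * h x) := by
    intro x
    rw [hh]
    simp only [hf]
    rw [Complex.ofReal_mul (Real.exp _), Complex.ofReal_exp, ← mul_assoc, ← mul_assoc,
      ← Complex.exp_add, ← Complex.exp_add, hAdef]
    congr 2
    push_cast
    ring
  simp only [hI]
  rw [integral_const_mul, hP, norm_mul, Complex.norm_exp_ofReal_mul_I, one_mul, norm_mul]
  have hx := norm_nonneg (((Real.pi : ℂ) / (1 - Complex.I * t * A)) ^ (1 / 2 : ℂ))
  constructor
  · rw [mul_right_comm]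
    exact mul_le_mul hN.1 hJ.1 (by norm_num) hx
  · rw [mul_right_comm (_ ^ (1 / 2 : ℝ)) 2]
    exact mul_le_mul hN.2 hJ.2 (norm_nonneg _) (by positivity)
end
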